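/- There exists a constant ε > 0 (with ε ≈ 10^{-5}) such that for all integers q and Δ there is a constant η = η(q,Δ) with the following property: for every list-coloring instance (G, L) with maximum degree at most Δ, lists L(v) ⊆ [q], and |L(v)| ≥ max((11/6 − ε)·Δ, Δ+2) for all v ∈ V, the uniform distribution μ over proper list-colorings satisfies, for every partial proper list-coloring ξ : A → [q] (A ⊆ V) that extends to a full proper list-coloring, every u ∈ V∖A, and every c ∈ L(u) with Pr_{σ∼μ|ξ}[σ(u)=c] > 0: ∑_{v∈V∖A} ∑_{c'∈L(v)} |Pr_{σ∼μ|ξ}[σ(v)=c' | σ(u)=c] − Pr_{σ∼μ|ξ}[σ(v)=c']| ≤ η. In particular μ and all of its conditional distributions are spectrally independent with parameter bounded in terms of q and Δ only. -/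

import Mathlib

open Finset

attribute [local instance] Classical.propDecidable

/-- `μ` is a probability distribution on the finite type `Ω`. -/
def IsProbDist {Ω : Type*} [Fintype Ω] (μ : Ω → ℝ) : Prop :=
  (∀ x, 0 ≤ μ x) ∧ ∑ x, μ x = 1

/-- `P` is a row-stochastic transition matrix whose dynamics is supported on `Ω₀`
(transitions out of `Ω₀` are impossible, and off `Ω₀` the matrix is extended as the identity,
so that `P` together with its powers faithfully represents a Markov chain on state space `Ω₀`). -/
def IsTransOn {Ω : Type*} [Fintype Ω] [DecidableEq Ω] (P : Matrix Ω Ω ℝ) (Ω₀ : Set Ω) : Prop :=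
  (∀ x y, 0 ≤ P x y) ∧ (∀ x, ∑ y, P x y = 1) ∧
    (∀ x ∈ Ω₀, ∀ y, P x y ≠ 0 → y ∈ Ω₀) ∧
    (∀ x, x ∉ Ω₀ → ∀ y, P x y = if x = y then 1 else 0)

/-- `P` is reversible with respect to `π`. -/
def ReversibleWrt {Ω : Type*} (P : Matrix Ω Ω ℝ) (π : Ω → ℝ) : Prop :=
  ∀ x y, π x * P x y = π y * P y x

/-- `π` is stationary for `P`. -/
def StationaryWrt {Ω : Type*} [Fintype Ω] (P : Matrix Ω Ω ℝ) (π : Ω → ℝ) : Prop :=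
  ∀ y, ∑ x, π x * P x y = π y

/-- `P` is irreducible on the state space `Ω₀`. -/
def IrreducibleOn {Ω : Type*} [Fintype Ω] [DecidableEq Ω] (P : Matrix Ω Ω ℝ) (Ω₀ : Set Ω) : Prop :=
  ∀ x ∈ Ω₀, ∀ y ∈ Ω₀, ∃ t : ℕ, 0 < (P ^ t) x y

/-- `P` is aperiodic on the state space `Ω₀`: for every state, the gcd of the return
times is `1` (every common divisor of the return times equals `1`). -/
def AperiodicOn {Ω : Type*} [Fintype Ω] [DecidableEq Ω] (P : Matrix Ω Ω ℝ) (Ω₀ : Set Ω) : Prop :=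
  ∀ x ∈ Ω₀, ∀ d : ℕ, 0 < d → (∀ t : ℕ, 0 < t → 0 < (P ^ t) x x → d ∣ t) → d = 1

/-- A coupling of two faithful copies of the chain `P`, recorded through its time-`t` joint
distributions: `coup x y t a b` is the probability that `(X t, Y t) = (a, b)` given the starting
states `X 0 = x` and `Y 0 = y`; marginally each copy evolves according to `P`. -/
def IsCoupling {Ω : Type*} [Fintype Ω] [DecidableEq Ω] (P : Matrix Ω Ω ℝ)
    (coup : Ω → Ω → ℕ → Ω → Ω → ℝ) : Prop :=
  (∀ x y t a b, 0 ≤ coup x y t a b) ∧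
    (∀ x y t a, ∑ b, coup x y t a b = (P ^ t) x a) ∧
    (∀ x y t b, ∑ a, coup x y t a b = (P ^ t) y b)

/-- Hamming distance between two finite sets: the size of their symmetric difference. -/
def hamm {U : Type*} [DecidableEq U] (S T : Finset U) : ℕ := ((S \ T) ∪ (T \ S)).card

/-- `margOf μ j = Pr_{S ∼ μ}[j ∈ S]`. -/
def margOf {U : Type*} [Fintype U] [DecidableEq U] (μ : Finset U → ℝ) (j : U) : ℝ :=
  ∑ S : Finset U, if j ∈ S then μ S else 0

/-- `μ` conditioned on the event `{S : A ⊆ S}`. -/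
noncomputable def condOn {U : Type*} [Fintype U] [DecidableEq U] (μ : Finset U → ℝ)
    (A : Finset U) : Finset U → ℝ := fun S =>
  if A ⊆ S then μ S / ∑ T : Finset U, (if A ⊆ T then μ T else 0) else 0

section ListColoring

variable {V : Type*} [Fintype V] [DecidableEq V] {q : ℕ}

/-- `σ` is a proper list-coloring of the instance `(G, L)`. -/
def IsProperListColoring (G : SimpleGraph V) (L : V → Finset (Fin q)) (σ : V → Fin q) : Prop :=
  (∀ v, σ v ∈ L v) ∧ ∀ u v, G.Adj u v → σ u ≠ σ v

/-- One step of an alternating path inside the active vertex set `Vs`, using only the two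
colors `a` and `b`. -/
def kempeStep (G : SimpleGraph V) (Vs : Finset V) (σ : V → Fin q) (a b : Fin q)
    (w w' : V) : Prop :=
  w ∈ Vs ∧ w' ∈ Vs ∧ G.Adj w w' ∧ (σ w = a ∨ σ w = b) ∧ (σ w' = a ∨ σ w' = b) ∧ σ w ≠ σ w'

/-- The Kempe component `S_σ(u,c)` (within the active vertex set `Vs`): all vertices reachable
from `u` along an alternating path using the colors `σ u` and `c`. -/
noncomputable def kempeComp (G : SimpleGraph V) (Vs : Finset V) (σ : V → Fin q)
    (u : V) (c : Fin q) : Finset V :=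
  Finset.univ.filter fun v => Relation.ReflTransGen (kempeStep G Vs σ (σ u) c) u v

/-- The coloring obtained from `σ` by interchanging the colors `a` and `b` on `S`. -/
def flipConf (σ : V → Fin q) (a b : Fin q) (S : Finset V) : V → Fin q := fun v =>
  if v ∈ S then (if σ v = a then b else if σ v = b then a else σ v) else σ v

/-- The flip dynamics with flip parameters `p`: pick a uniformly random active vertex
`v ∈ Vs` and a uniformly random color `c` from the pick-list `Lpick v`; if the Kempe
component `S = S_σ(v,c)` (within `Vs`) is flippable (i.e. the flipped coloring is a proper
list-coloring for `(G, L)`), flip it with probability `p |S| / |S|`, otherwise stay. -/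
noncomputable def flipMatrix (G : SimpleGraph V) (Vs : Finset V)
    (Lpick L : V → Finset (Fin q)) (p : ℕ → ℝ) :
    Matrix (V → Fin q) (V → Fin q) ℝ := fun σ τ =>
  (Vs.card : ℝ)⁻¹ * ∑ v ∈ Vs, ((Lpick v).card : ℝ)⁻¹ * ∑ c ∈ Lpick v,
    ((if IsProperListColoring G L (flipConf σ (σ v) c (kempeComp G Vs σ v c)) ∧
          τ = flipConf σ (σ v) c (kempeComp G Vs σ v c)
        then p (kempeComp G Vs σ v c).card / ((kempeComp G Vs σ v c).card : ℝ) else 0) +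
      (if τ = σ then
          1 - (if IsProperListColoring G L (flipConf σ (σ v) c (kempeComp G Vs σ v c))
              then p (kempeComp G Vs σ v c).card / ((kempeComp G Vs σ v c).card : ℝ) else 0)
        else 0))

end ListColoring

/-- The number of proper list-colorings of `(G, L)` satisfying the additional predicate `Q`. -/
noncomputable def properCount {V : Type*} [Fintype V] [DecidableEq V] {q : ℕ}
    (G : SimpleGraph V) (L : V → Finset (Fin q)) (Q : (V → Fin q) → Prop) : ℕ :=
  (Finset.univ.filter fun σ => IsProperListColoring G L σ ∧ Q σ).card

set_option linter.unusedSectionVars false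

section FlipDynamics

variable {V : Type*} [Fintype V]

/-- The vertex set of the connected component of `w` in `H`. -/
noncomputable def graphComp (H : SimpleGraph V) (w : V) : Finset V :=
  univ.filter fun z => H.Reachable w z

/-- The graph `H` with all edges at `v` removed. -/
def isolate (H : SimpleGraph V) (v : V) : SimpleGraph V where
  Adj z z' := H.Adj z z' ∧ z ≠ v ∧ z' ≠ v
  symm := ⟨fun _ _ h => ⟨h.1.symm, h.2.2, h.2.1⟩⟩
  loopless := ⟨fun _ h => H.loopless.irrefl _ h.1⟩

lemma mem_graphComp {H : SimpleGraph V} {w z : V} : z ∈ graphComp H w ↔ H.Reachable w z := by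
  simp [graphComp]

lemma self_mem_graphComp (H : SimpleGraph V) (w : V) : w ∈ graphComp H w :=
  mem_graphComp.2 (SimpleGraph.Reachable.refl w)

lemma graphComp_eq_of_reachable {H : SimpleGraph V} {w z : V} (h : H.Reachable w z) :
    graphComp H w = graphComp H z := by
  ext y
  rw [mem_graphComp, mem_graphComp]
  exact ⟨fun hy => h.symm.trans hy, fun hy => h.trans hy⟩

lemma graphComp_eq_of_mem {H : SimpleGraph V} {w z : V} (h : z ∈ graphComp H w) :
    graphComp H w = graphComp H z :=
  graphComp_eq_of_reachable (mem_graphComp.1 h)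

lemma graphComp_eq_or_disjoint (H : SimpleGraph V) (w z : V) :
    graphComp H w = graphComp H z ∨ Disjoint (graphComp H w) (graphComp H z) := by
  by_cases h : ∃ y, y ∈ graphComp H w ∧ y ∈ graphComp H z
  · obtain ⟨y, h1, h2⟩ := h
    exact Or.inl ((graphComp_eq_of_mem h1).trans (graphComp_eq_of_mem h2).symm)
  · right
    rw [Finset.disjoint_left]
    exact fun y h1 h2 => h ⟨y, h1, h2⟩

lemma graphComp_subset_of_closed {H : SimpleGraph V} {w : V} {S : Finset V} (hw : w ∈ S)
    (hS : ∀ y ∈ S, ∀ z, H.Adj y z → z ∈ S) : graphComp H w ⊆ S := by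
  intro z hz
  obtain ⟨p⟩ := mem_graphComp.1 hz
  clear hz
  induction p with
  | nil => exact hw
  | cons h _ ih => exact ih (hS _ hw _ h)

lemma isolate_le (H : SimpleGraph V) (v : V) : isolate H v ≤ H := fun _ _ h => h.1

lemma mem_graphComp_of_adj {H : SimpleGraph V} {w y z : V} (hy : y ∈ graphComp H w)
    (h : H.Adj y z) : z ∈ graphComp H w :=
  mem_graphComp.2 ((mem_graphComp.1 hy).trans h.reachable)

lemma graphComp_isolate_subset (H : SimpleGraph V) (v w : V) :
    graphComp (isolate H v) w ⊆ graphComp H w := fun _ hz =>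
  mem_graphComp.2 ((mem_graphComp.1 hz).mono (isolate_le H v))

lemma ne_of_mem_graphComp_isolate {H : SimpleGraph V} {v w z : V} (hw : w ≠ v)
    (hz : z ∈ graphComp (isolate H v) w) : z ≠ v := by
  have h : graphComp (isolate H v) w ⊆ univ.filter (fun z => z ≠ v) := by
    apply graphComp_subset_of_closed
    · simpa using hw
    · intro y _ z h
      simpa using h.2.2
  simpa using h hz

lemma graphComp_center (H : SimpleGraph V) (v : V) :
    graphComp H v =
      insert v ((univ.filter fun w => H.Adj v w).biUnion (graphComp (isolate H v))) := by
  apply subset_antisymm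
  · apply graphComp_subset_of_closed
    · simp
    · intro y hy z hyz
      by_cases hzv : z = v
      · simp [hzv]
      rw [mem_insert, mem_biUnion]
      right
      by_cases hyv : y = v
      · subst hyv
        exact ⟨z, by simpa using hyz, self_mem_graphComp _ _⟩
      · rw [mem_insert, mem_biUnion] at hy
        obtain ⟨w, hw, hyw⟩ := hy.resolve_left hyv
        exact ⟨w, hw, mem_graphComp_of_adj hyw ⟨hyz, hyv, hzv⟩⟩
  · intro z hz
    rw [mem_insert, mem_biUnion] at hz
    rcases hz with rfl | ⟨w, hw, hz⟩
    · exact self_mem_graphComp _ _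
    · have hvw : H.Adj v w := by simpa using hw
      exact mem_graphComp.2 (hvw.reachable.trans
        (mem_graphComp.1 (graphComp_isolate_subset H v w hz)))

lemma graphComp_of_detached {H : SimpleGraph V} {v w : V} (hw : w ≠ v)
    (h : ∀ z ∈ graphComp (isolate H v) w, ¬ H.Adj v z) :
    graphComp H w = graphComp (isolate H v) w := by
  apply subset_antisymm _ (graphComp_isolate_subset H v w)
  apply graphComp_subset_of_closed (self_mem_graphComp _ _)
  intro y hy z hyz
  have hyv := ne_of_mem_graphComp_isolate hw hy
  by_cases hzv : z = v
  · subst hzv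
    exact absurd hyz.symm (h y hy)
  · exact mem_graphComp_of_adj hy ⟨hyz, hyv, hzv⟩

lemma graphComp_of_attached {H : SimpleGraph V} {v w z : V}
    (hz : z ∈ graphComp (isolate H v) w) (h : H.Adj v z) : graphComp H w = graphComp H v := by
  rw [graphComp_eq_of_mem (graphComp_isolate_subset H v w hz)]
  exact graphComp_eq_of_reachable h.reachable.symm

variable {q : ℕ}

/-- The graph of edges of `G` whose two ends carry the two colors `x` and `y`. -/
def kempeGraph (G : SimpleGraph V) (σ : V → Fin q) (x y : Fin q) : SimpleGraph V where
  Adj w z := G.Adj w z ∧ (σ w = x ∧ σ z = y ∨ σ w = y ∧ σ z = x)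
  symm := ⟨fun _ _ h => ⟨h.1.symm, h.2.symm.imp And.symm And.symm⟩⟩
  loopless := ⟨fun _ h => G.loopless.irrefl _ h.1⟩

lemma kempeGraph_comm (G : SimpleGraph V) (σ : V → Fin q) (x y : Fin q) :
    kempeGraph G σ x y = kempeGraph G σ y x := by
  ext w z
  simp only [kempeGraph]
  tauto

/-- The Kempe components of `σ` in the colors `x` and `y`. -/
noncomputable def kempeComps (G : SimpleGraph V) (σ : V → Fin q) (x y : Fin q) :
    Finset (Finset V) :=
  (univ.filter fun w => σ w = x ∨ σ w = y).image (graphComp (kempeGraph G σ x y))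

/-- The component of `w` in the colors `x` and `y` after removal of the vertex `v`. -/
noncomputable def restComp (G : SimpleGraph V) (v : V) (σ : V → Fin q) (x y : Fin q) (w : V) :
    Finset V :=
  graphComp (isolate (kempeGraph G σ x y) v) w

/-- The Kempe components of `σ` in the colors `x` and `y` after removal of the vertex `v`. -/
noncomputable def restComps (G : SimpleGraph V) (v : V) (σ : V → Fin q) (x y : Fin q) :
    Finset (Finset V) :=
  (univ.filter fun w => w ≠ v ∧ (σ w = x ∨ σ w = y)).image (restComp G v σ x y)

lemma restComp_congr (G : SimpleGraph V) {v : V} {σ τ : V → Fin q} (h : ∀ w, w ≠ v → σ w = τ w)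
    (x y : Fin q) : restComp G v σ x y = restComp G v τ x y := by
  have : isolate (kempeGraph G σ x y) v = isolate (kempeGraph G τ x y) v := by
    ext w z
    simp only [isolate, kempeGraph]
    constructor <;> rintro ⟨h1, h2, h3⟩ <;> simpa [h _ h2, h _ h3, h2, h3] using h1
  funext w
  rw [restComp, restComp, this]

lemma restComps_congr (G : SimpleGraph V) {v : V} {σ τ : V → Fin q}
    (h : ∀ w, w ≠ v → σ w = τ w) (x y : Fin q) : restComps G v σ x y = restComps G v τ x y := by
  rw [restComps, restComps, restComp_congr G h]
  congr 1
  ext w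
  simp only [mem_filter, mem_univ, true_and]
  constructor <;> rintro ⟨h1, h2⟩ <;> simpa [h _ h1, h1] using h2

lemma restComp_comm (G : SimpleGraph V) (v : V) (σ : V → Fin q) (x y : Fin q) :
    restComp G v σ x y = restComp G v σ y x := by
  funext w
  rw [restComp, restComp, kempeGraph_comm]

lemma self_mem_restComp (G : SimpleGraph V) (v : V) (σ : V → Fin q) (x y : Fin q) (w : V) :
    w ∈ restComp G v σ x y w := self_mem_graphComp _ _

lemma ne_of_mem_restComp {G : SimpleGraph V} {v : V} {σ : V → Fin q} {x y : Fin q} {w z : V}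
    (hw : w ≠ v) (hz : z ∈ restComp G v σ x y w) : z ≠ v :=
  ne_of_mem_graphComp_isolate hw hz

lemma restComp_eq_of_mem {G : SimpleGraph V} {v : V} {σ : V → Fin q} {x y : Fin q} {w z : V}
    (h : z ∈ restComp G v σ x y w) : restComp G v σ x y w = restComp G v σ x y z :=
  graphComp_eq_of_mem h

lemma exists_of_mem_restComps {G : SimpleGraph V} {v : V} {σ : V → Fin q} {x y : Fin q}
    {C : Finset V} (hC : C ∈ restComps G v σ x y) :
    ∃ w, w ≠ v ∧ (σ w = x ∨ σ w = y) ∧ restComp G v σ x y w = C := by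
  simpa [restComps, and_assoc] using hC

lemma notMem_of_mem_restComps {G : SimpleGraph V} {v : V} {σ : V → Fin q} {x y : Fin q}
    {C : Finset V} (hC : C ∈ restComps G v σ x y) : v ∉ C := by
  obtain ⟨w, hw, -, rfl⟩ := exists_of_mem_restComps hC
  exact fun h => ne_of_mem_restComp hw h rfl

lemma eq_restComp_of_mem {G : SimpleGraph V} {v : V} {σ : V → Fin q} {x y : Fin q}
    {C : Finset V} (hC : C ∈ restComps G v σ x y) {z : V} (hz : z ∈ C) :
    C = restComp G v σ x y z := by
  obtain ⟨w, hw, -, rfl⟩ := exists_of_mem_restComps hC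
  exact restComp_eq_of_mem hz

/-- The Kempe components of `σ` are the one of `v` together with those components of the
coloring without `v` that no two-colored edge joins to `v`. -/
lemma sum_kempeComps (G : SimpleGraph V) (v : V) (σ : V → Fin q) (x y : Fin q)
    (F : Finset V → ℝ) :
    ∑ S ∈ kempeComps G σ x y, F S =
      (if σ v = x ∨ σ v = y then F (graphComp (kempeGraph G σ x y) v) else 0) +
        ∑ C ∈ (restComps G v σ x y).filter
          (fun C => ∀ z ∈ C, ¬ (kempeGraph G σ x y).Adj v z), F C := by
  set B := (restComps G v σ x y).filter
    (fun C => ∀ z ∈ C, ¬ (kempeGraph G σ x y).Adj v z) with hB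
  have hvB : graphComp (kempeGraph G σ x y) v ∉ B := fun h =>
    notMem_of_mem_restComps (mem_filter.1 h).1 (self_mem_graphComp _ _)
  have hcol : ∀ z, (kempeGraph G σ x y).Adj v z → (σ v = x ∨ σ v = y) := by
    rintro z ⟨-, h | h⟩
    exacts [Or.inl h.1, Or.inr h.1]
  have hmem : ∀ S, S ∈ kempeComps G σ x y ↔
      ((σ v = x ∨ σ v = y) ∧ S = graphComp (kempeGraph G σ x y) v) ∨ S ∈ B := by
    intro S
    simp only [hB, kempeComps, restComps, mem_image, mem_filter, mem_univ, true_and]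
    constructor
    · rintro ⟨w, hw, rfl⟩
      by_cases hwv : w = v
      · subst hwv
        exact Or.inl ⟨hw, rfl⟩
      by_cases h : ∀ z ∈ restComp G v σ x y w, ¬ (kempeGraph G σ x y).Adj v z
      · right
        have := graphComp_of_detached hwv h
        exact ⟨⟨w, ⟨hwv, hw⟩, this.symm⟩, by rw [this]; exact h⟩
      · left
        push Not at h
        obtain ⟨z, hz, hvz⟩ := h
        exact ⟨hcol z hvz, graphComp_of_attached hz hvz⟩
    · rintro (⟨h, rfl⟩ | ⟨⟨w, ⟨hwv, hw⟩, rfl⟩, h⟩)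
      · exact ⟨v, h, rfl⟩
      · exact ⟨w, hw, graphComp_of_detached hwv h⟩
  by_cases hv : σ v = x ∨ σ v = y
  · have : kempeComps G σ x y = insert (graphComp (kempeGraph G σ x y) v) B := by
      ext S
      rw [hmem, mem_insert]
      tauto
    rw [this, sum_insert hvB, if_pos hv]
  · have : kempeComps G σ x y = B := by
      ext S
      rw [hmem]
      tauto
    rw [this, if_neg hv, zero_add]

end FlipDynamics

section FlipDynamics

/-- The rate at which a Kempe component with `k` vertices is flipped. -/
noncomputable def flipRate : ℕ → ℝ
  | 1 => 1
  | 2 => 3 / 10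
  | 3 => 1 / 6 - 1 / 10000
  | 4 => 51 / 500
  | 5 => 117 / 2000
  | 6 => 13 / 500
  | _ => 0

lemma flipRate_of_seven_le {k : ℕ} (hk : 7 ≤ k) : flipRate k = 0 := by
  obtain ⟨n, rfl⟩ := Nat.exists_eq_add_of_le' hk
  rfl

lemma flipRate_cases {P : ℕ → Prop} (k : ℕ) (h0 : P 0) (h1 : P 1) (h2 : P 2) (h3 : P 3) (h4 : P 4)
    (h5 : P 5) (h6 : P 6) (h7 : ∀ k, 7 ≤ k → P k) : P k := by
  by_cases hk : 7 ≤ k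
  · exact h7 k hk
  · push Not at hk
    interval_cases k <;> assumption

lemma flipRate_nonneg (k : ℕ) : 0 ≤ flipRate k := by
  induction k using flipRate_cases with
  | h7 k hk7 => rw [flipRate_of_seven_le hk7]
  | _ => norm_num [flipRate]

lemma flipRate_le_one (k : ℕ) : flipRate k ≤ 1 := by
  induction k using flipRate_cases with
  | h7 k hk7 => rw [flipRate_of_seven_le hk7]; norm_num
  | _ => norm_num [flipRate]

lemma flipRate_succ_le {k : ℕ} (hk : 1 ≤ k) : flipRate (k + 1) ≤ flipRate k := by
  induction k using flipRate_cases with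
  | h7 k hk7 => rw [flipRate_of_seven_le hk7, flipRate_of_seven_le (by omega)]
  | h0 => omega
  | _ => norm_num [flipRate]

lemma flipRate_anti {k l : ℕ} (hk : 1 ≤ k) (hkl : k ≤ l) : flipRate l ≤ flipRate k := by
  induction l, hkl using Nat.le_induction with
  | base => exact le_rfl
  | succ l hl ih => exact (flipRate_succ_le (hk.trans hl)).trans ih

lemma flipRate_mul_le (k : ℕ) : flipRate k * k ≤ 1 := by
  induction k using flipRate_cases with
  | h7 k hk7 => rw [flipRate_of_seven_le hk7]; norm_num
  | _ => norm_num [flipRate]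

lemma flipRate_mul_sub_one_le (k : ℕ) : flipRate k * (k - 1) ≤ 1 / 3 - 2 / 10000 := by
  induction k using flipRate_cases with
  | h7 k hk7 => rw [flipRate_of_seven_le hk7]; norm_num
  | _ => norm_num [flipRate]

lemma flipRate_mul_sub_two_le {k : ℕ} (hk : 2 ≤ k) : flipRate k * (k - 2) ≤ 21 / 100 := by
  induction k using flipRate_cases with
  | h7 k hk7 => rw [flipRate_of_seven_le hk7]; norm_num
  | _ => norm_num [flipRate]

lemma flipRate_mul_sub_one_le_of_four_le {k : ℕ} (hk : 4 ≤ k) :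
    flipRate k * (k - 1) ≤ 306 / 1000 := by
  induction k using flipRate_cases with
  | h7 k hk7 => rw [flipRate_of_seven_le hk7]; norm_num
  | h4 | h5 | h6 => norm_num [flipRate]
  | _ => omega

lemma flipRate_mul_sub_five_le {k : ℕ} (hk : 4 ≤ k) :
    flipRate k * (k - 5) ≤ 26 / 1000 := by
  induction k using flipRate_cases with
  | h7 k hk7 => rw [flipRate_of_seven_le hk7]; norm_num
  | h4 | h5 | h6 => norm_num [flipRate]
  | _ => omega

lemma flipRate_diff_mul_le (k : ℕ) : (flipRate k - flipRate (k + 1)) * k ≤ 7 / 10 := by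
  induction k using flipRate_cases with
  | h7 k hk7 => rw [flipRate_of_seven_le hk7, flipRate_of_seven_le (by omega)]; norm_num
  | _ => norm_num [flipRate]

lemma flipRate_diff_mul_le_of_ne_one {k : ℕ} (hk : k ≠ 1) :
    (flipRate k - flipRate (k + 1)) * k ≤ 3 / 10 := by
  induction k using flipRate_cases with
  | h7 k hk7 => rw [flipRate_of_seven_le hk7, flipRate_of_seven_le (by omega)]; norm_num
  | h1 => omega
  | _ => norm_num [flipRate]

lemma flipRate_diff_mul_sub_one_le {k : ℕ} (hk : 1 ≤ k) :
    (flipRate k - flipRate (k + 1)) * (k - 1) ≤ 2 / 15 + 1 / 10000 := by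
  induction k using flipRate_cases with
  | h7 k hk7 => rw [flipRate_of_seven_le hk7, flipRate_of_seven_le (by omega)]; norm_num
  | h0 => omega
  | _ => norm_num [flipRate]

lemma flipRate_diff_mul_sub_one_le_of_ne_two {k : ℕ} (hk1 : 1 ≤ k) (hk : k ≠ 2) :
    (flipRate k - flipRate (k + 1)) * (k - 1) ≤ 1305 / 10000 := by
  induction k using flipRate_cases with
  | h7 k hk7 => rw [flipRate_of_seven_le hk7, flipRate_of_seven_le (by omega)]; norm_num
  | h2 => omega
  | h0 => omega
  | _ => norm_num [flipRate]

variable {V : Type*} [Fintype V] {q : ℕ}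

/-- The coloring `σ` with the colors `x` and `y` interchanged on `S`. -/
noncomputable def kempeFlip (x y : Fin q) (S : Finset V) (σ : V → Fin q) : V → Fin q :=
  fun z => if z ∈ S then Equiv.swap x y (σ z) else σ z

/-- The rate at which the colors `x` and `y` are interchanged on `S`: moves that leave the lists
are suppressed. -/
noncomputable def moveRate (L : V → Finset (Fin q)) (x y : Fin q) (S : Finset V)
    (σ : V → Fin q) : ℝ :=
  if ∀ z ∈ S, Equiv.swap x y (σ z) ∈ L z then flipRate S.card else 0

/-- The contribution of the colors `x` and `y` to the generator of the flip dynamics. -/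
noncomputable def pairGen (G : SimpleGraph V) (L : V → Finset (Fin q)) (f : (V → Fin q) → ℝ)
    (σ : V → Fin q) (x y : Fin q) : ℝ :=
  ∑ S ∈ kempeComps G σ x y, moveRate L x y S σ * (f (kempeFlip x y S σ) - f σ)

/-- The generator of the flip dynamics (every pair of colors is counted in both orders). -/
noncomputable def flipGen (G : SimpleGraph V) (L : V → Finset (Fin q)) (f : (V → Fin q) → ℝ)
    (σ : V → Fin q) : ℝ :=
  ∑ x, ∑ y, pairGen G L f σ x y

/-- `f` is `1`-Lipschitz for the Hamming distance. -/
def HammingLip (f : (V → Fin q) → ℝ) : Prop :=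
  ∀ (σ τ : V → Fin q) (D : Finset V), (∀ z, z ∉ D → σ z = τ z) → f σ - f τ ≤ D.card

/-- The colorings `σ` and `τ` differ exactly at `v`. -/
structure DifferAt (v : V) (σ τ : V → Fin q) : Prop where
  off : ∀ w, w ≠ v → σ w = τ w
  ne : σ v ≠ τ v

lemma DifferAt.symm {v : V} {σ τ : V → Fin q} (h : DifferAt v σ τ) : DifferAt v τ σ :=
  ⟨fun w hw => (h.off w hw).symm, h.ne.symm⟩

lemma HammingLip.neg {f : (V → Fin q) → ℝ} (hf : HammingLip f) : HammingLip (fun σ => - f σ) := by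
  intro σ τ D h
  have := hf τ σ D (fun z hz => (h z hz).symm)
  linarith

lemma moveRate_nonneg (L : V → Finset (Fin q)) (x y : Fin q) (S : Finset V) (σ : V → Fin q) :
    0 ≤ moveRate L x y S σ := by
  unfold moveRate
  split_ifs
  exacts [flipRate_nonneg _, le_rfl]

lemma moveRate_le (L : V → Finset (Fin q)) (x y : Fin q) (S : Finset V) (σ : V → Fin q) :
    moveRate L x y S σ ≤ flipRate S.card := by
  unfold moveRate
  split_ifs
  exacts [le_rfl, flipRate_nonneg _]

lemma moveRate_le_one (L : V → Finset (Fin q)) (x y : Fin q) (S : Finset V) (σ : V → Fin q) :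
    moveRate L x y S σ ≤ 1 := (moveRate_le L x y S σ).trans (flipRate_le_one _)

lemma moveRate_mul_card_le (L : V → Finset (Fin q)) (x y : Fin q) (S : Finset V)
    (σ : V → Fin q) : moveRate L x y S σ * S.card ≤ 1 :=
  (mul_le_mul_of_nonneg_right (moveRate_le L x y S σ) (Nat.cast_nonneg _)).trans
    (flipRate_mul_le _)

lemma moveRate_congr (L : V → Finset (Fin q)) (x y : Fin q) {S : Finset V} {σ τ : V → Fin q}
    (h : ∀ z ∈ S, σ z = τ z) : moveRate L x y S σ = moveRate L x y S τ := by
  unfold moveRate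
  congr 1
  exact propext (forall₂_congr fun z hz => by rw [h z hz])

lemma moveRate_comm (L : V → Finset (Fin q)) (x y : Fin q) (S : Finset V) (σ : V → Fin q) :
    moveRate L x y S σ = moveRate L y x S σ := by
  unfold moveRate
  rw [Equiv.swap_comm]

lemma kempeFlip_comm (x y : Fin q) (S : Finset V) (σ : V → Fin q) :
    kempeFlip x y S σ = kempeFlip y x S σ := by
  unfold kempeFlip
  rw [Equiv.swap_comm]

section LipschitzBounds

variable {f : (V → Fin q) → ℝ} (hf : HammingLip f) {v : V} {σ τ : V → Fin q}
  (h : DifferAt v σ τ)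

include hf

lemma HammingLip.self_sub_flip_le (x y : Fin q) (C : Finset V) :
    f τ - f (kempeFlip x y C τ) ≤ C.card :=
  hf _ _ C fun z hz => by simp [kempeFlip, hz]

include h

lemma HammingLip.flip_sub_le {T : Finset V} (hv : v ∈ T) (x y : Fin q) :
    f (kempeFlip x y T σ) - f τ ≤ T.card := by
  refine hf _ _ T fun z hz => ?_
  have hzv : z ≠ v := fun e => hz (e ▸ hv)
  simp [kempeFlip, hz, h.off z hzv]

lemma HammingLip.flip_sub_flip_le {T C : Finset V} (hv : v ∈ T) (hCT : C ⊆ T) (hvC : v ∉ C)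
    (x y : Fin q) :
    f (kempeFlip x y T σ) - f (kempeFlip x y C τ) ≤ (T.card : ℝ) - C.card := by
  have h1 := hf (kempeFlip x y T σ) (kempeFlip x y C τ) (T \ C) fun z hz => by
    rw [mem_sdiff, not_and_not_right] at hz
    by_cases hzC : z ∈ C
    · have hzv : z ≠ v := fun e => hvC (e ▸ hzC)
      simp [kempeFlip, hzC, hCT hzC, h.off z hzv]
    · have hzT : z ∉ T := fun e => hzC (hz e)
      have hzv : z ≠ v := fun e => hzT (e ▸ hv)
      simp [kempeFlip, hzC, hzT, h.off z hzv]
  rwa [card_sdiff_of_subset hCT, Nat.cast_sub (card_le_card hCT)] at h1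

lemma HammingLip.flip_center_sub_le {T : Finset V} (hv : v ∈ T) :
    f (kempeFlip (σ v) (τ v) T σ) - f τ ≤ (T.card : ℝ) - 1 := by
  have h1 := hf (kempeFlip (σ v) (τ v) T σ) τ (T.erase v) fun z hz => by
    by_cases hzv : z = v
    · subst hzv
      simp [kempeFlip, hv]
    · have hzT : z ∉ T := fun e => hz (mem_erase.2 ⟨hzv, e⟩)
      simp [kempeFlip, hzT, h.off z hzv]
  rwa [card_erase_of_mem hv, Nat.cast_sub (card_pos.2 ⟨v, hv⟩), Nat.cast_one] at h1

lemma HammingLip.flip_center_sub_flip_le {T C : Finset V} (hv : v ∈ T) (hCT : C ⊆ T)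
    (hvC : v ∉ C) :
    f (kempeFlip (σ v) (τ v) T σ) - f (kempeFlip (σ v) (τ v) C τ) ≤ (T.card : ℝ) - 1 - C.card := by
  have hCT' : C ⊆ T.erase v := fun z hz => mem_erase.2 ⟨fun e => hvC (e ▸ hz), hCT hz⟩
  have h1 := hf (kempeFlip (σ v) (τ v) T σ) (kempeFlip (σ v) (τ v) C τ) (T.erase v \ C)
    fun z hz => by
      rw [mem_sdiff, not_and_not_right, mem_erase] at hz
      by_cases hzv : z = v
      · subst hzv
        simp [kempeFlip, hv, hvC]
      by_cases hzC : z ∈ C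
      · simp [kempeFlip, hzC, hCT hzC, h.off z hzv]
      · have hzT : z ∉ T := fun e => hzC (hz ⟨hzv, e⟩)
        simp [kempeFlip, hzC, hzT, h.off z hzv]
  rwa [card_sdiff_of_subset hCT', Nat.cast_sub (card_le_card hCT'), card_erase_of_mem hv,
    Nat.cast_sub (card_pos.2 ⟨v, hv⟩), Nat.cast_one] at h1

/-- Interchanging `σ v` with `c` in `σ` and `τ v` with `c` in `τ` makes the colorings agree at
`v`. -/
lemma HammingLip.flip_sub_flip_of_center_le {T T' N : Finset V} (hvT : v ∈ T) (hvT' : v ∈ T')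
    (hN : N ⊆ T) (hN' : N ⊆ T') (hvN : v ∉ N) (c : Fin q) :
    f (kempeFlip (σ v) c T σ) - f (kempeFlip (τ v) c T' τ) ≤
      (T.card : ℝ) + T'.card - 2 - N.card := by
  have h1 := hf (kempeFlip (σ v) c T σ) (kempeFlip (τ v) c T' τ) ((T ∪ T').erase v)
    fun z hz => by
      by_cases hzv : z = v
      · subst hzv
        simp [kempeFlip, hvT, hvT']
      rw [mem_erase, not_and, mem_union, not_or] at hz
      obtain ⟨hzT, hzT'⟩ := hz hzv
      simp [kempeFlip, hzT, hzT', h.off z hzv]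
  have h2 : insert v N ⊆ T ∩ T' := by
    intro z hz
    rcases mem_insert.1 hz with rfl | hz
    · exact mem_inter.2 ⟨hvT, hvT'⟩
    · exact mem_inter.2 ⟨hN hz, hN' hz⟩
  have h3 := card_le_card h2
  rw [card_insert_of_notMem hvN] at h3
  have h4 := card_union_add_card_inter T T'
  have h5 := card_erase_add_one (mem_union_left T' hvT)
  have h6 : (((T ∪ T').erase v).card : ℝ) + 2 + N.card ≤ T.card + T'.card := by
    exact_mod_cast (by omega : ((T ∪ T').erase v).card + 2 + N.card ≤ T.card + T'.card)
  linarith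

lemma HammingLip.flip_sub_flip_of_common_le {C D : Finset V} {w : V} (hC : w ∈ C) (hD : w ∈ D)
    (x y x' y' : Fin q) :
    f (kempeFlip x' y' D σ) - f (kempeFlip x y C τ) ≤ (C.card : ℝ) + D.card := by
  have h1 := hf (kempeFlip x' y' D σ) (kempeFlip x y C τ) (insert v (C ∪ D))
    fun z hz => by
      rw [mem_insert, mem_union, not_or, not_or] at hz
      simp [kempeFlip, hz, h.off z hz.1]
  have h3 : 1 ≤ (C ∩ D).card := card_pos.2 ⟨w, mem_inter.2 ⟨hC, hD⟩⟩
  have h4 := card_union_add_card_inter C D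
  have h5 := card_insert_le v (C ∪ D)
  have h6 : ((insert v (C ∪ D)).card : ℝ) ≤ C.card + D.card := by
    exact_mod_cast (by omega : (insert v (C ∪ D)).card ≤ C.card + D.card)
  linarith

end LipschitzBounds

end FlipDynamics

section Certificates

/-- The part of the drift that a component with `k` vertices may use in excess of `1`. -/
noncomputable def excess (k : ℕ) : ℝ := if k = 1 then 1 / 6 else 1 / 3 - 2 / 10000

lemma excess_one : excess 1 = 1 / 6 := if_pos rfl

lemma excess_of_ne_one {k : ℕ} (hk : k ≠ 1) : excess k = 1 / 3 - 2 / 10000 := if_neg hk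

lemma excess_le (k : ℕ) : excess k ≤ 1 / 3 - 2 / 10000 := by
  unfold excess
  split_ifs <;> norm_num

lemma mul_sub_one_le_excess {r : ℝ} {k : ℕ} (hr : r ≤ flipRate k) (hk : 1 ≤ k) :
    r * (k - 1) ≤ excess k := by
  have hk' : (1 : ℝ) ≤ k := by exact_mod_cast hk
  by_cases h : k = 1
  · subst h
    norm_num [excess]
  · rw [excess_of_ne_one h]
    exact (mul_le_mul_of_nonneg_right hr (by linarith)).trans (flipRate_mul_sub_one_le k)

/-- Two rates `r` and `s` on variables `x ≤ a` and `y ≤ b` with `x + y ≤ a + b - 1 + u`. -/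
lemma two_rate_bound {r s x y a b u : ℝ} (hr0 : 0 ≤ r) (hr1 : r ≤ 1) (hs0 : 0 ≤ s) (hs1 : s ≤ 1)
    (hx : x ≤ a) (hy : y ≤ b) (hxy : x + y ≤ a + b - 1 + u) (hu : 0 ≤ u) :
    r * x + s * y ≤ max (r * (a - 1) + s * b) (r * a + s * (b - 1)) + u := by
  rcases le_total s r with h | h
  · have h1 := mul_le_mul_of_nonneg_left hxy hs0
    have h2 := mul_le_mul_of_nonneg_left hx (sub_nonneg.2 h)
    have h3 := mul_le_mul_of_nonneg_right hs1 hu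
    have h4 := le_max_right (r * (a - 1) + s * b) (r * a + s * (b - 1))
    linarith
  · have h1 := mul_le_mul_of_nonneg_left hxy hr0
    have h2 := mul_le_mul_of_nonneg_left hy (sub_nonneg.2 h)
    have h3 := mul_le_mul_of_nonneg_right hr1 hu
    have h4 := le_max_left (r * (a - 1) + s * b) (r * a + s * (b - 1))
    linarith

variable {V : Type*}

/-- The quantity `S` is, up to the error `e`, a combination of the `x w` whose coefficients are
small enough with respect to the sizes `a w`. -/
def Certified (N : Finset V) (a : V → ℕ) (x : V → ℝ) (S e : ℝ) : Prop :=
  ∃ r K : V → ℝ, (∀ w ∈ N, 0 ≤ r w ∧ r w ≤ 1 ∧ r w * (a w - 1) + K w ≤ excess (a w) ∧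
    r w * a w + K w ≤ 1) ∧ S ≤ e + ∑ w ∈ N, (r w * x w + K w)

lemma Certified.add_le {N : Finset V} {a b : V → ℕ} {x y : V → ℝ} {S S' e e' u : ℝ}
    (h : Certified N a x S e) (h' : Certified N b y S' e')
    (hx : ∀ w ∈ N, x w ≤ a w) (hy : ∀ w ∈ N, y w ≤ b w)
    (hxy : ∀ w ∈ N, x w + y w ≤ (a w : ℝ) + b w - 1 + u) (hu : 0 ≤ u) :
    S + S' ≤ e + e' + ∑ w ∈ N, (1 + max (excess (a w)) (excess (b w)) + u) := by
  obtain ⟨r, K, hr, hS⟩ := h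
  obtain ⟨s, K', hs, hS'⟩ := h'
  have key : ∑ w ∈ N, (r w * x w + K w) + ∑ w ∈ N, (s w * y w + K' w) ≤
      ∑ w ∈ N, (1 + max (excess (a w)) (excess (b w)) + u) := by
    rw [← sum_add_distrib]
    refine sum_le_sum fun w hw => ?_
    obtain ⟨hr0, hr1, hr2, hr3⟩ := hr w hw
    obtain ⟨hs0, hs1, hs2, hs3⟩ := hs w hw
    have h1 := two_rate_bound hr0 hr1 hs0 hs1 (hx w hw) (hy w hw) (hxy w hw) hu
    have h2 : max (r w * (a w - 1) + s w * b w) (r w * a w + s w * (b w - 1)) ≤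
        1 + max (excess (a w)) (excess (b w)) - K w - K' w := by
      have h3 := le_max_left (excess (a w)) (excess (b w))
      have h4 := le_max_right (excess (a w)) (excess (b w))
      exact max_le (by linarith) (by linarith)
    linarith
  linarith

lemma sum_image_eq_sum_div {ι κ : Type*} [DecidableEq κ] (N : Finset ι) (R : ι → κ) (g : κ → ℝ) :
    ∑ C ∈ N.image R, g C = ∑ w ∈ N, g (R w) / ((N.filter fun w' => R w' = R w).card : ℝ) := by
  rw [← sum_fiberwise_of_maps_to (g := R) (t := N.image R) (fun w hw => mem_image_of_mem R hw)]
  refine sum_congr rfl fun C hC => ?_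
  have h1 : ∀ w ∈ N.filter (fun w => R w = C),
      g (R w) / ((N.filter fun w' => R w' = R w).card : ℝ) =
        g C / ((N.filter fun w' => R w' = C).card : ℝ) := by
    intro w hw
    rw [(mem_filter.1 hw).2]
  rw [sum_congr rfl h1, sum_const, nsmul_eq_mul]
  obtain ⟨w, hw, rfl⟩ := mem_image.1 hC
  have hne : ((N.filter fun w' => R w' = R w).card : ℝ) ≠ 0 :=
    Nat.cast_ne_zero.2 (card_pos.2 ⟨w, by simp [hw]⟩).ne'
  field_simp

/-- The rate at which `S` is flipped if exactly the vertices satisfying `ok` may change. -/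
noncomputable def okRate (ok : V → Prop) (S : Finset V) : ℝ :=
  if ∀ z ∈ S, ok z then flipRate S.card else 0

lemma okRate_nonneg (ok : V → Prop) (S : Finset V) : 0 ≤ okRate ok S := by
  unfold okRate
  split_ifs
  exacts [flipRate_nonneg _, le_rfl]

lemma okRate_le (ok : V → Prop) (S : Finset V) : okRate ok S ≤ flipRate S.card := by
  unfold okRate
  split_ifs
  exacts [le_rfl, flipRate_nonneg _]

lemma okRate_le_one (ok : V → Prop) (S : Finset V) : okRate ok S ≤ 1 :=
  (okRate_le ok S).trans (flipRate_le_one _)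

lemma okRate_mul_card_le (ok : V → Prop) (S : Finset V) : okRate ok S * S.card ≤ 1 :=
  (mul_le_mul_of_nonneg_right (okRate_le ok S) (Nat.cast_nonneg _)).trans (flipRate_mul_le _)

lemma okRate_eq {ok : V → Prop} {S : Finset V} (h : okRate ok S ≠ 0) :
    okRate ok S = flipRate S.card := by
  unfold okRate at h ⊢
  split_ifs at h ⊢ <;> simp_all

lemma okRate_of_subset {ok : V → Prop} {S S' : Finset V} (h : okRate ok S' ≠ 0) (hS : S ⊆ S') :
    okRate ok S = flipRate S.card := by
  have h1 : ∀ z ∈ S', ok z := by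
    by_contra h1
    exact h (if_neg h1)
  exact if_pos fun z hz => h1 z (hS hz)

/-- The components `R w` with `w ∈ N` merge with `v` in one coloring, where flipping the merged
component changes the test function by `X`; in the other coloring flipping `C` changes it by
`- x C`. -/
structure MergeData (N : Finset V) (v : V) (R : V → Finset V) (u X : ℝ) (x : Finset V → ℝ) :
    Prop where
  self_mem : ∀ w ∈ N, w ∈ R w
  notMem : ∀ w ∈ N, v ∉ R w
  eq_or_disjoint : ∀ w ∈ N, ∀ w' ∈ N, R w = R w' ∨ Disjoint (R w) (R w')
  x_le : ∀ w ∈ N, x (R w) ≤ (R w).card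
  X_le : X ≤ ((insert v (N.biUnion R)).card : ℝ) - 1 + u
  X_add_le : ∀ w ∈ N, X + x (R w) ≤ ((insert v (N.biUnion R)).card : ℝ) - (R w).card - 1 + u

/-- The contribution of the merged component and of its pieces to the drift. -/
noncomputable def mergeSum (N : Finset V) (v : V) (R : V → Finset V) (ok : V → Prop) (X : ℝ)
    (x : Finset V → ℝ) : ℝ :=
  okRate ok (insert v (N.biUnion R)) * X + ∑ C ∈ N.image R, okRate ok C * x C

variable {N : Finset V} {v : V} {R : V → Finset V} {u X : ℝ} {x : Finset V → ℝ}

namespace MergeData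

lemma one_le_card (h : MergeData N v R u X x) {w : V} (hw : w ∈ N) : 1 ≤ (R w).card :=
  card_pos.2 ⟨w, h.self_mem w hw⟩

lemma notMem_biUnion (h : MergeData N v R u X x) : v ∉ N.biUnion R := by
  rw [mem_biUnion]
  rintro ⟨w, hw, hv⟩
  exact h.notMem w hw hv

lemma card_insert (h : MergeData N v R u X x) :
    (insert v (N.biUnion R)).card = (N.biUnion R).card + 1 :=
  card_insert_of_notMem h.notMem_biUnion

lemma card_le_card_biUnion (h : MergeData N v R u X x) : N.card ≤ (N.biUnion R).card :=
  card_le_card fun w hw => mem_biUnion.2 ⟨w, hw, h.self_mem w hw⟩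

lemma certified_of_le (h : MergeData N v R u X x) (ok : V → Prop) {e : ℝ}
    (he : okRate ok (insert v (N.biUnion R)) * X ≤ e) :
    Certified N (fun w => (R w).card) (fun w => x (R w)) (mergeSum N v R ok X x) e := by
  refine ⟨fun w => okRate ok (R w) / ((N.filter fun w' => R w' = R w).card : ℝ), fun _ => 0,
    fun w hw => ?_, ?_⟩
  · have hm : (1 : ℝ) ≤ ((N.filter fun w' => R w' = R w).card : ℝ) :=
      Nat.one_le_cast.2 (card_pos.2 ⟨w, mem_filter.2 ⟨hw, rfl⟩⟩)
    have h1 := div_le_self (okRate_nonneg ok (R w)) hm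
    have h2 := mul_le_mul_of_nonneg_right h1 (Nat.cast_nonneg (R w).card)
    have h3 := okRate_mul_card_le ok (R w)
    refine ⟨div_nonneg (okRate_nonneg _ _) (by linarith), h1.trans (okRate_le_one _ _), ?_,
      by linarith⟩
    rw [add_zero]
    exact mul_sub_one_le_excess (h1.trans (okRate_le _ _)) (h.one_le_card hw)
  · rw [mergeSum, sum_image_eq_sum_div N R fun C => okRate ok C * x C]
    have : ∀ w, okRate ok (R w) * x (R w) / ((N.filter fun w' => R w' = R w).card : ℝ) =
      okRate ok (R w) / ((N.filter fun w' => R w' = R w).card : ℝ) * x (R w) + 0 := fun w => by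
        ring
    rw [sum_congr rfl fun w _ => this w]
    linarith

lemma certified_pair_of_card_le {w₁ w₂ : V} (h : MergeData {w₁, w₂} v R u X x) (hne : w₁ ≠ w₂)
    (hu : 0 ≤ u) {ok : V → Prop} (hok : okRate ok (insert v (({w₁, w₂} : Finset V).biUnion R)) ≠ 0)
    (hle : (R w₁).card ≤ (R w₂).card) :
    Certified {w₁, w₂} (fun w => (R w).card) (fun w => x (R w))
      (mergeSum {w₁, w₂} v R ok X x) u := by
  have hw₁ : w₁ ∈ ({w₁, w₂} : Finset V) := by simp
  have hw₂ : w₂ ∈ ({w₁, w₂} : Finset V) := by simp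
  have ha₁ := h.one_le_card hw₁
  have hXx := h.X_add_le w₂ hw₂
  have hα := okRate_eq hok
  have hr₁ : okRate ok (R w₁) = flipRate (R w₁).card := okRate_of_subset hok <|
    (subset_biUnion_of_mem R hw₁).trans (subset_insert _ _)
  have hr₂ : okRate ok (R w₂) = flipRate (R w₂).card := okRate_of_subset hok <|
    (subset_biUnion_of_mem R hw₂).trans (subset_insert _ _)
  have hcard := h.card_insert
  have hα0 := okRate_nonneg ok (insert v (({w₁, w₂} : Finset V).biUnion R))
  have hα1 := okRate_le_one ok (insert v (({w₁, w₂} : Finset V).biUnion R))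
  unfold mergeSum
  rcases h.eq_or_disjoint w₁ hw₁ w₂ hw₂ with heq | hdisj
  · have hbi : ({w₁, w₂} : Finset V).biUnion R = R w₂ := by
      simp [heq]
    rw [hbi] at hα hα0 hα1 hXx hcard ⊢
    have h2 : 2 ≤ (R w₂).card := by
      rw [← card_pair hne]
      exact card_le_card (insert_subset (heq ▸ h.self_mem w₁ hw₁)
        (singleton_subset_iff.2 (h.self_mem w₂ hw₂)))
    have himg : ({w₁, w₂} : Finset V).image R = {R w₂} := by simp [heq]
    have hanti : okRate ok (insert v (R w₂)) ≤ flipRate (R w₂).card := by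
      rw [hα, hcard]
      exact flipRate_succ_le (by omega)
    have hb := flipRate_mul_le (R w₂).card
    have hb' := flipRate_mul_sub_one_le (R w₂).card
    have hb1 := flipRate_le_one (R w₂).card
    rw [hcard] at hXx
    push_cast at hXx
    generalize okRate ok (insert v (R w₂)) = α at *
    have h2' : (2 : ℝ) ≤ ((R w₂).card : ℝ) := by exact_mod_cast h2
    have hex : excess (R w₂).card = 1 / 3 - 2 / 10000 := excess_of_ne_one (by omega)
    have main : 0 ≤ (flipRate (R w₂).card - α) / 2 ∧ (flipRate (R w₂).card - α) / 2 ≤ 1 ∧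
        (flipRate (R w₂).card - α) / 2 * ((R w₂).card - 1) + 0 ≤ excess (R w₂).card ∧
        (flipRate (R w₂).card - α) / 2 * (R w₂).card + 0 ≤ 1 := by
      refine ⟨by linarith, by linarith, ?_, ?_⟩
      · rw [hex]
        nlinarith
      · nlinarith
    refine ⟨fun _ => (flipRate (R w₂).card - α) / 2, fun _ => 0, fun w hw => ?_, ?_⟩
    · rcases mem_insert.1 hw with rfl | hw
      · simpa only [heq] using main
      · rw [mem_singleton.1 hw]
        exact main
    · simp only [himg, sum_singleton, sum_pair hne, heq, hr₂]
      have hXx' : X + x (R w₂) ≤ u := by linarith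
      nlinarith
  · have hbi : (({w₁, w₂} : Finset V).biUnion R).card = (R w₁).card + (R w₂).card := by
      rw [biUnion_insert, singleton_biUnion, card_union_of_disjoint hdisj]
    have hRne : R w₁ ≠ R w₂ := fun e => by
      rw [e, disjoint_self_iff_empty] at hdisj
      have := h.self_mem w₂ hw₂
      simp [hdisj] at this
    have himg : ({w₁, w₂} : Finset V).image R = {R w₁, R w₂} := by simp
    rw [hcard, hbi] at hXx hα
    push_cast at hXx
    generalize okRate ok (insert v (({w₁, w₂} : Finset V).biUnion R)) = α at *
    have hXx' : α * (X + x (R w₂)) ≤ α * (R w₁).card + u := by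
      have : X + x (R w₂) ≤ (R w₁).card + u := by linarith
      nlinarith
    have hp₁ := flipRate_mul_le (R w₁).card
    have hp₂ := flipRate_mul_le (R w₂).card
    have hp₁' := mul_sub_one_le_excess (le_refl (flipRate (R w₁).card)) ha₁
    have hp₂' := mul_sub_one_le_excess (le_refl (flipRate (R w₂).card)) (ha₁.trans hle)
    have hα₂ : α ≤ flipRate (R w₂).card := by
      rw [hα]
      exact flipRate_anti (by omega) (by omega)
    have key : ∃ K₁ K₂ : ℝ, K₁ + K₂ = α * (R w₁).card ∧
        flipRate (R w₁).card * ((R w₁).card - 1) + K₁ ≤ excess (R w₁).card ∧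
        flipRate (R w₁).card * (R w₁).card + K₁ ≤ 1 ∧
        (flipRate (R w₂).card - α) * ((R w₂).card - 1) + K₂ ≤ excess (R w₂).card ∧
        (flipRate (R w₂).card - α) * (R w₂).card + K₂ ≤ 1 := by
      generalize (R w₁).card = k at *
      generalize (R w₂).card = l at *
      rcases hle.lt_or_eq with hlt | rfl
      · have hlt' : (k : ℝ) + 1 ≤ l := by exact_mod_cast hlt
        refine ⟨0, α * k, by ring, by linarith, by linarith, ?_, ?_⟩
        · have h5 : (flipRate l - α) * (l - 1) + α * k =
              flipRate l * (l - 1) + α * (k + 1 - l) := by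
            ring
          nlinarith
        · nlinarith
      · have hk3 : k ≤ 2 := by
          by_contra hk3
          exact hok (hα.trans (flipRate_of_seven_le (by omega)))
        interval_cases k
        · refine ⟨0, α, by norm_num, by norm_num [excess], by norm_num [flipRate], ?_, ?_⟩ <;>
            norm_num [excess, hα, flipRate]
        · refine ⟨α / 2, 3 * α / 2, by norm_num; ring, ?_, ?_, ?_, ?_⟩ <;>
            norm_num [excess, hα, flipRate]
    obtain ⟨K₁, K₂, hK, h1, h2, h3, h4⟩ := key
    refine ⟨fun w => if w = w₁ then flipRate (R w₁).card else flipRate (R w₂).card - α,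
      fun w => if w = w₁ then K₁ else K₂, fun w hw => ?_, ?_⟩
    · rcases mem_insert.1 hw with rfl | hw
      · simp only [if_true]
        exact ⟨flipRate_nonneg _, flipRate_le_one _, h1, h2⟩
      · rw [mem_singleton.1 hw]
        simp only [if_neg hne.symm]
        refine ⟨by linarith, ?_, h3, h4⟩
        have := flipRate_le_one (R w₂).card
        linarith
    · rw [himg, sum_pair hRne, sum_pair hne, hr₁, hr₂]
      simp only [if_true, if_neg hne.symm]
      nlinarith

lemma certified_of_card_eq_two (h : MergeData N v R u X x) (hu : 0 ≤ u) (hN : N.card = 2)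
    (ok : V → Prop) :
    Certified N (fun w => (R w).card) (fun w => x (R w)) (mergeSum N v R ok X x) u := by
  by_cases hok : okRate ok (insert v (N.biUnion R)) = 0
  · exact h.certified_of_le ok (by rw [hok, zero_mul]; exact hu)
  obtain ⟨w₁, w₂, hne, rfl⟩ := card_eq_two.1 hN
  rcases le_total (R w₁).card (R w₂).card with hle | hle
  · exact h.certified_pair_of_card_le hne hu hok hle
  · rw [pair_comm] at h hok ⊢
    exact h.certified_pair_of_card_le hne.symm hu hok hle

lemma le_of_singleton {w : V} (h : MergeData {w} v R u X x) (hu : 0 ≤ u) {ok : V → Prop}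
    (hok : ok v) :
    mergeSum {w} v R ok X x ≤
      (if ∀ z ∈ R w, ok z then flipRate (R w).card - flipRate ((R w).card + 1) else 0) * x (R w) +
        u := by
  have hw : w ∈ ({w} : Finset V) := mem_singleton_self w
  have hcard := h.card_insert
  have hXx := h.X_add_le w hw
  unfold mergeSum
  rw [singleton_biUnion] at hcard hXx ⊢
  rw [image_singleton, sum_singleton]
  split_ifs with hC
  · have h1 : okRate ok (insert v (R w)) = flipRate ((R w).card + 1) := by
      rw [← hcard]
      refine if_pos fun z hz => ?_
      rcases mem_insert.1 hz with rfl | hz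
      exacts [hok, hC z hz]
    have h2 : okRate ok (R w) = flipRate (R w).card := if_pos hC
    rw [h1, h2]
    have h3 := flipRate_nonneg ((R w).card + 1)
    have h4 := flipRate_le_one ((R w).card + 1)
    rw [hcard] at hXx
    push_cast at hXx
    have h5 : X + x (R w) ≤ u := by linarith
    nlinarith
  · have h1 : okRate ok (insert v (R w)) = 0 :=
      if_neg fun hall => hC fun z hz => hall z (mem_insert_of_mem hz)
    have h2 : okRate ok (R w) = 0 := if_neg hC
    rw [h1, h2]
    linarith

end MergeData

/-- The two merged components of size at least four contribute little. -/
lemma two_merged_bound {α β X Y u : ℝ} {t t' : ℕ} (hα0 : 0 ≤ α) (hβ0 : 0 ≤ β)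
    (hα : α ≤ flipRate t) (hβ : β ≤ flipRate t') (ht : 4 ≤ t) (ht' : 4 ≤ t')
    (hu : 0 ≤ u) (hX : X ≤ t - 1 + u) (hY : Y ≤ t' - 1 + u) (hXY : X + Y ≤ (t : ℝ) + t' - 6 + u) :
    α * X + β * Y ≤ 332 / 1000 + u := by
  have aux : ∀ {α β X Y : ℝ} {t t' : ℕ}, 0 ≤ α → 0 ≤ β → α ≤ flipRate t → β ≤ flipRate t' →
      4 ≤ t → 4 ≤ t' → X ≤ t - 1 + u → X + Y ≤ (t : ℝ) + t' - 6 + u → β ≤ α →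
      α * X + β * Y ≤ 332 / 1000 + u := by
    intro α β X Y t t' hα0 hβ0 hα hβ ht ht' hX hXY hle
    have ht1 : (4 : ℝ) ≤ t := by exact_mod_cast ht
    have h1 := mul_le_mul_of_nonneg_left hXY hβ0
    have h2 := mul_le_mul_of_nonneg_left hX (sub_nonneg.2 hle)
    have h3 : α * (t - 1) ≤ 306 / 1000 :=
      (mul_le_mul_of_nonneg_right hα (by linarith)).trans (flipRate_mul_sub_one_le_of_four_le ht)
    have h4 : β * (t' - 5) ≤ 26 / 1000 := by
      rcases le_total (t' : ℝ) 5 with h | h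
      · nlinarith
      · exact (mul_le_mul_of_nonneg_right hβ (by linarith)).trans (flipRate_mul_sub_five_le ht')
    have h5 : α * u ≤ 1 * u := mul_le_mul_of_nonneg_right (hα.trans (flipRate_le_one _)) hu
    linarith
  rcases le_total β α with h | h
  · exact aux hα0 hβ0 hα hβ ht ht' hX hXY h
  · have := @aux β α Y X t' t hβ0 hα0 hβ hα ht' ht hY (by linarith) h
    linarith

end Certificates

section ColorBound

variable {V : Type*}

/-- The weight available for the neighbors of `v` in one color: it depends on how the colors in
question block the neighbor. -/
structure WeightData (N : Finset V) (R : V → Finset V) (R' : V → Finset V) (ok : V → Prop)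
    (W : V → ℝ) : Prop where
  free : ∀ w ∈ N, 11 / 6 - 1 / 20 ≤ W w
  blocked : ∀ w ∈ N, (R w).card ≠ 1 → 11 / 6 - 2 / 10000 ≤ W w
  pair : ∀ w ∈ N, (R w).card = 2 → (R' w).card = 1 → (∀ z ∈ R w, ok z) →
    11 / 6 + 1 / 10000 ≤ W w

/-- The difference of the rates of a component and of its extension by one vertex. -/
noncomputable def diffRate (ok : V → Prop) (C : Finset V) : ℝ :=
  if ∀ z ∈ C, ok z then flipRate C.card - flipRate (C.card + 1) else 0

lemma diffRate_nonneg (ok : V → Prop) {C : Finset V} (hC : 1 ≤ C.card) : 0 ≤ diffRate ok C := by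
  unfold diffRate
  split_ifs
  · exact sub_nonneg.2 (flipRate_succ_le hC)
  · exact le_rfl

lemma diffRate_le {ok : V → Prop} {C : Finset V} (hC : 1 ≤ C.card) :
    diffRate ok C ≤ flipRate C.card - flipRate (C.card + 1) := by
  unfold diffRate
  split_ifs
  · exact le_rfl
  · exact sub_nonneg.2 (flipRate_succ_le hC)

lemma diffRate_le_one (ok : V → Prop) {C : Finset V} (hC : 1 ≤ C.card) : diffRate ok C ≤ 1 := by
  have h1 := diffRate_le (ok := ok) hC
  have h2 := flipRate_le_one C.card
  have h3 := flipRate_nonneg (C.card + 1)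
  linarith

lemma diffRate_pair_bound {N : Finset V} {R R' : V → Finset V} {ok ok' : V → Prop} {W : V → ℝ}
    (hW : WeightData N R R' ok W) {w : V} (hw : w ∈ N) (hR : 1 ≤ (R w).card)
    (hR' : 1 ≤ (R' w).card) :
    diffRate ok (R w) * ((R w).card - 1) + diffRate ok' (R' w) * (R' w).card ≤ W w - 1 := by
  have hfree := hW.free w hw
  have hRr : (1 : ℝ) ≤ (R w).card := by exact_mod_cast hR
  have h1 : diffRate ok (R w) * ((R w).card - 1) ≤
      (flipRate (R w).card - flipRate ((R w).card + 1)) * ((R w).card - 1) :=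
    mul_le_mul_of_nonneg_right (diffRate_le hR) (by linarith)
  have h2 : diffRate ok' (R' w) * (R' w).card ≤
      (flipRate (R' w).card - flipRate ((R' w).card + 1)) * (R' w).card :=
    mul_le_mul_of_nonneg_right (diffRate_le hR') (Nat.cast_nonneg _)
  have h3 := flipRate_diff_mul_sub_one_le hR
  have h4 := flipRate_diff_mul_le (R' w).card
  by_cases hb : (R' w).card = 1
  · by_cases ha : (R w).card = 1
    · have h0 : diffRate ok (R w) * ((R w).card - 1) = 0 := by
        rw [ha]
        norm_num
      linarith
    · have hblocked := hW.blocked w hw ha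
      by_cases ha2 : (R w).card = 2
      · by_cases hC : ∀ z ∈ R w, ok z
        · have := hW.pair w hw ha2 hb hC
          linarith
        · have h0 : diffRate ok (R w) = 0 := if_neg hC
          rw [h0]
          linarith
      · have := flipRate_diff_mul_sub_one_le_of_ne_two hR ha2
        linarith
  · have := flipRate_diff_mul_le_of_ne_one hb
    linarith

/-- The drift caused by one color `c` different from the two colors of `v`. -/
lemma mergeSum_add_le {N : Finset V} {v : V} {R R' : V → Finset V} {u X Y : ℝ}
    {x y : Finset V → ℝ} {ok ok' : V → Prop} {W : V → ℝ} {p : Prop} [Decidable p]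
    (h : MergeData N v R u X x) (h' : MergeData N v R' u Y y) (hu : 0 ≤ u) (hu1 : u ≤ 1)
    (hxy : ∀ w ∈ N, x (R w) + y (R' w) ≤ ((R w).card : ℝ) + (R' w).card - 1 + u)
    (hXY : X + Y ≤ ((insert v (N.biUnion R)).card : ℝ) + (insert v (N.biUnion R')).card - 3 -
      N.card + u)
    (hp : ok v ↔ p) (hp' : ok' v ↔ p)
    (hW : WeightData N R R' ok W) (hW' : WeightData N R' R ok' W) :
    mergeSum N v R ok X x + mergeSum N v R' ok' Y y + (if p then 1 - u else 0) ≤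
      ∑ w ∈ N, W w + 4 * u * N.card := by
  have hif : (if p then 1 - u else 0) ≤ (1 : ℝ) := by split_ifs <;> linarith
  have hfree : ∀ w ∈ N, (1 : ℝ) + max (excess (R w).card) (excess (R' w).card) + u ≤
      4 / 3 - 2 / 10000 + u := fun w _ => by
    have := max_le (excess_le (R w).card) (excess_le (R' w).card)
    linarith
  have hWsum : (11 / 6 - 1 / 20 : ℝ) * N.card ≤ ∑ w ∈ N, W w := by
    have := card_nsmul_le_sum N W _ hW.free
    rwa [nsmul_eq_mul, mul_comm] at this
  have hup : ∑ w ∈ N, ((1 : ℝ) + max (excess (R w).card) (excess (R' w).card) + u) ≤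
      (4 / 3 - 2 / 10000 + u) * N.card := by
    have := sum_le_card_nsmul N _ _ hfree
    rwa [nsmul_eq_mul, mul_comm] at this
  have hnop : ¬ p → mergeSum N v R ok X x + mergeSum N v R' ok' Y y ≤
      ∑ w ∈ N, ((1 : ℝ) + max (excess (R w).card) (excess (R' w).card) + u) := by
    intro hnp
    have h1 : okRate ok (insert v (N.biUnion R)) = 0 :=
      if_neg fun hall => hnp (hp.1 (hall v (mem_insert_self _ _)))
    have h2 : okRate ok' (insert v (N.biUnion R')) = 0 :=
      if_neg fun hall => hnp (hp'.1 (hall v (mem_insert_self _ _)))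
    have := (h.certified_of_le ok (e := 0) (by rw [h1, zero_mul])).add_le
      (h'.certified_of_le ok' (e := 0) (by rw [h2, zero_mul])) h.x_le h'.x_le hxy hu
    linarith
  by_cases hp0 : p
  swap
  · rw [if_neg hp0]
    have h1 := hnop hp0
    have h2 : (0 : ℝ) ≤ N.card := Nat.cast_nonneg _
    nlinarith
  obtain hN | hN | hN | hN : N.card = 0 ∨ N.card = 1 ∨ N.card = 2 ∨ 3 ≤ N.card := by omega
  · have hN0 := card_eq_zero.1 hN
    subst hN0
    simp only [biUnion_empty, insert_empty_eq, card_singleton, card_empty] at hXY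
    have h1 : ok v := hp.2 hp0
    have h2 : ok' v := hp'.2 hp0
    simp only [mergeSum, biUnion_empty, insert_empty_eq, okRate, mem_singleton, forall_eq, h1, h2,
      if_true, card_singleton, flipRate, image_empty, sum_empty, if_pos hp0, card_empty]
    norm_num at hXY ⊢
    linarith
  · obtain ⟨w, rfl⟩ := card_eq_one.1 hN
    have hw : w ∈ ({w} : Finset V) := mem_singleton_self w
    have h1 := h.le_of_singleton hu (hp.2 hp0)
    have h2 := h'.le_of_singleton hu (hp'.2 hp0)
    have hR := h.one_le_card hw
    have hR' := h'.one_le_card hw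
    have h3 := diffRate_pair_bound (ok' := ok') hW hw hR hR'
    have h4 := diffRate_pair_bound (ok' := ok) hW' hw hR' hR
    have h5 := two_rate_bound (diffRate_nonneg ok hR) (diffRate_le_one ok hR)
      (diffRate_nonneg ok' hR') (diffRate_le_one ok' hR') (h.x_le w hw) (h'.x_le w hw)
      (hxy w hw) hu
    have h6 := max_le h3 (by linarith : diffRate ok (R w) * (R w).card +
      diffRate ok' (R' w) * ((R' w).card - 1) ≤ W w - 1)
    unfold diffRate at h5 h6
    rw [if_pos hp0, sum_singleton, card_singleton, Nat.cast_one]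
    linarith
  · have h1 := (h.certified_of_card_eq_two hu hN ok).add_le
      (h'.certified_of_card_eq_two hu hN ok') h.x_le h'.x_le hxy hu
    have h2 : ∑ w ∈ N, ((1 : ℝ) + max (excess (R w).card) (excess (R' w).card) + u) ≤
        ∑ w ∈ N, (W w - 1 / 2 + u) := by
      refine sum_le_sum fun w hw => ?_
      have : max (excess (R w).card) (excess (R' w).card) ≤ W w - 3 / 2 := by
        have hf := hW.free w hw
        refine max_le ?_ ?_
        · by_cases h1 : (R w).card = 1
          · rw [h1, excess_one]
            linarith
          · have := hW.blocked w hw h1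
            rw [excess_of_ne_one h1]
            linarith
        · by_cases h1 : (R' w).card = 1
          · rw [h1, excess_one]
            linarith
          · have := hW'.blocked w hw h1
            rw [excess_of_ne_one h1]
            linarith
      linarith
    have h3 : ∑ w ∈ N, (W w - 1 / 2 + u) = ∑ w ∈ N, W w - 1 + 2 * u := by
      rw [sum_add_distrib, sum_sub_distrib, sum_const, sum_const, hN]
      simp only [nsmul_eq_mul]
      norm_num
    rw [hN]
    push_cast
    linarith
  · have hN3 : (3 : ℝ) ≤ N.card := by exact_mod_cast hN
    have ht := h.card_insert
    have ht' := h'.card_insert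
    have hb := h.card_le_card_biUnion
    have hb' := h'.card_le_card_biUnion
    have h1 := two_merged_bound (okRate_nonneg ok _) (okRate_nonneg ok' _) (okRate_le ok _)
      (okRate_le ok' _) (by omega) (by omega) hu h.X_le h'.X_le (by linarith)
    have h2 := (h.certified_of_le ok le_rfl).add_le (h'.certified_of_le ok' le_rfl) h.x_le h'.x_le
      hxy hu
    nlinarith

/-- The drift caused by the two colors of `v`, for one of the two colorings. -/
lemma half_merge_le {N : Finset V} {v : V} {R : V → Finset V} {u X : ℝ} {x : Finset V → ℝ}
    {ok : V → Prop} {W : V → ℝ} (P : Finset V → Prop) [DecidablePred P] (hu : 0 ≤ u)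
    (hself : ∀ w ∈ N, w ∈ R w) (hv : ∀ w ∈ N, v ∉ R w)
    (hx : ∀ w ∈ N, x (R w) ≤ (R w).card)
    (hX : X ≤ ((insert v (N.biUnion R)).card : ℝ) - 2 + u)
    (hXx : ∀ w ∈ N, X + x (R w) ≤ ((insert v (N.biUnion R)).card : ℝ) - (R w).card - 2 + u)
    (hok : ok v) (hW : ∀ w ∈ N, 11 / 6 - 1 / 20 ≤ W w) :
    okRate ok (insert v (N.biUnion R)) * X + ∑ C ∈ (N.image R).filter P, okRate ok C * x C +
      (1 - u) ≤ ∑ w ∈ N, W w + 4 * u * N.card := by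
  have hvN : v ∉ N.biUnion R := by
    rw [mem_biUnion]
    rintro ⟨w, hw, h⟩
    exact hv w hw h
  have hcard : (insert v (N.biUnion R)).card = (N.biUnion R).card + 1 := card_insert_of_notMem hvN
  have hNb : N.card ≤ (N.biUnion R).card :=
    card_le_card fun w hw => mem_biUnion.2 ⟨w, hw, hself w hw⟩
  have hWsum : (11 / 6 - 1 / 20 : ℝ) * N.card ≤ ∑ w ∈ N, W w := by
    have := card_nsmul_le_sum N W _ hW
    rwa [nsmul_eq_mul, mul_comm] at this
  have hX' : N ≠ ∅ → okRate ok (insert v (N.biUnion R)) * X ≤ 21 / 100 + u := by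
    intro hN
    have h1 : 1 ≤ N.card := card_pos.2 (nonempty_iff_ne_empty.2 hN)
    have h2 : (2 : ℝ) ≤ ((insert v (N.biUnion R)).card : ℝ) := by
      exact_mod_cast (by omega : 2 ≤ (insert v (N.biUnion R)).card)
    have h3 := flipRate_mul_sub_two_le (k := (insert v (N.biUnion R)).card) (by omega)
    have h4 := okRate_nonneg ok (insert v (N.biUnion R))
    have h5 := okRate_le ok (insert v (N.biUnion R))
    have h6 := okRate_le_one ok (insert v (N.biUnion R))
    have h7 := mul_le_mul_of_nonneg_left hX h4
    have h8 := mul_le_mul_of_nonneg_right h5 (sub_nonneg.2 h2)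
    have h9 := mul_le_mul_of_nonneg_right h6 hu
    linarith
  obtain hN | hN | hN : N.card = 0 ∨ N.card = 1 ∨ 2 ≤ N.card := by omega
  · have hN0 := card_eq_zero.1 hN
    subst hN0
    simp only [biUnion_empty, insert_empty_eq, card_singleton] at hX
    simp only [biUnion_empty, insert_empty_eq, okRate, mem_singleton, forall_eq, hok,
      if_true, card_singleton, flipRate, image_empty, filter_empty, sum_empty, card_empty]
    norm_num at hX ⊢
    linarith
  · obtain ⟨w, rfl⟩ := card_eq_one.1 hN
    have hw : w ∈ ({w} : Finset V) := mem_singleton_self w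
    have hfree := hW w hw
    by_cases hP : P (R w)
    · have hR : 1 ≤ (R w).card := card_pos.2 ⟨w, hself w hw⟩
      have h1 := hXx w hw
      have h0 := hx w hw
      have h2 := flipRate_diff_mul_le (R w).card
      rw [image_singleton, filter_singleton, if_pos hP, sum_singleton, sum_singleton,
        card_singleton, Nat.cast_one]
      rw [singleton_biUnion] at hcard h1 ⊢
      by_cases hC : ∀ z ∈ R w, ok z
      · have h3 : okRate ok (insert v (R w)) = flipRate ((R w).card + 1) := by
          rw [← hcard]
          refine if_pos fun z hz => ?_
          rcases mem_insert.1 hz with rfl | hz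
          exacts [hok, hC z hz]
        have h4 : okRate ok (R w) = flipRate (R w).card := if_pos hC
        have h5 := flipRate_nonneg ((R w).card + 1)
        have h6 := flipRate_le_one ((R w).card + 1)
        have h7 := flipRate_succ_le hR
        rw [h3, h4]
        rw [hcard] at h1
        push_cast at h1
        have h8 : X + x (R w) ≤ u := by linarith
        have h9 := mul_le_mul_of_nonneg_left h8 h5
        have h10 := mul_le_mul_of_nonneg_left h0 (sub_nonneg.2 h7)
        have h11 := mul_le_mul_of_nonneg_right h6 hu
        linarith
      · have h3 : okRate ok (insert v (R w)) = 0 :=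
          if_neg fun hall => hC fun z hz => hall z (mem_insert_of_mem hz)
        have h4 : okRate ok (R w) = 0 := if_neg hC
        rw [h3, h4]
        linarith
    · rw [image_singleton, filter_singleton, if_neg hP, sum_empty, sum_singleton, card_singleton,
        Nat.cast_one]
      have h1 := hX' (singleton_ne_empty w)
      linarith
  · have hN2 : (2 : ℝ) ≤ N.card := by exact_mod_cast hN
    have h1 := hX' fun h => by simp [h] at hN
    have h2 : ∑ C ∈ (N.image R).filter P, okRate ok C * x C ≤ N.card := by
      have h3 : ∀ C ∈ (N.image R).filter P, okRate ok C * x C ≤ 1 := by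
        intro C hC
        obtain ⟨w, hw, rfl⟩ := mem_image.1 (mem_filter.1 hC).1
        exact (mul_le_mul_of_nonneg_left (hx w hw) (okRate_nonneg _ _)).trans
          (okRate_mul_card_le ok _)
      have h4 := sum_le_card_nsmul _ _ _ h3
      rw [nsmul_eq_mul, mul_one] at h4
      have h5 : (((N.image R).filter P).card : ℝ) ≤ N.card := by
        exact_mod_cast (card_filter_le _ _).trans card_image_le
      linarith
    nlinarith

end ColorBound

section Coupling

variable {V : Type*} [Fintype V] {q : ℕ}

/-- The neighbors of `v` with color `c`. -/
noncomputable def colorNbrs (G : SimpleGraph V) (v : V) (σ : V → Fin q) (c : Fin q) : Finset V :=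
  univ.filter fun w => G.Adj v w ∧ σ w = c

/-- The terms of the generator at `σ` that involve the component of `v`, together with the terms
at `τ` of the components that this component splits into. -/
noncomputable def sideTerm (G : SimpleGraph V) (L : V → Finset (Fin q)) (v : V)
    (f : (V → Fin q) → ℝ) (σ τ : V → Fin q) (x y : Fin q) : ℝ :=
  (if σ v = x ∨ σ v = y then
      moveRate L x y (graphComp (kempeGraph G σ x y) v) σ *
        (f (kempeFlip x y (graphComp (kempeGraph G σ x y) v) σ) - f σ) else 0) +
    ∑ C ∈ (restComps G v σ x y).filter (fun C => (∃ z ∈ C, (kempeGraph G σ x y).Adj v z) ∧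
      ∀ z ∈ C, ¬ (kempeGraph G τ x y).Adj v z), moveRate L x y C τ * (f τ - f (kempeFlip x y C τ))

/-- The components that `v` meets neither in `σ` nor in `τ`. -/
noncomputable def commonComps (G : SimpleGraph V) (v : V) (σ τ : V → Fin q) (x y : Fin q) :
    Finset (Finset V) :=
  (restComps G v σ x y).filter fun C =>
    ∀ z ∈ C, ¬ (kempeGraph G σ x y).Adj v z ∧ ¬ (kempeGraph G τ x y).Adj v z

lemma sum_filter_split {ι : Type*} (A : Finset ι) (P Q : ι → Prop) [DecidablePred P]
    [DecidablePred Q] (g : ι → ℝ) :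
    ∑ C ∈ A.filter P, g C =
      ∑ C ∈ A.filter (fun C => P C ∧ Q C), g C + ∑ C ∈ A.filter (fun C => P C ∧ ¬ Q C), g C := by
  rw [← sum_filter_add_sum_filter_not (A.filter P) Q, filter_filter, filter_filter]

lemma pairGen_sub_pairGen {G : SimpleGraph V} {L : V → Finset (Fin q)} {v : V}
    {σ τ : V → Fin q} (h : DifferAt v σ τ) (f : (V → Fin q) → ℝ) (x y : Fin q) :
    pairGen G L f σ x y - pairGen G L f τ x y =
      sideTerm G L v f σ τ x y + sideTerm G L v (fun ρ => - f ρ) τ σ x y +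
        ∑ C ∈ commonComps G v σ τ x y, moveRate L x y C σ *
          ((f (kempeFlip x y C σ) - f (kempeFlip x y C τ)) - (f σ - f τ)) := by
  unfold pairGen
  rw [sum_kempeComps G v σ x y, sum_kempeComps G v τ x y,
    sum_filter_split (restComps G v σ x y) _ (fun C => ∀ z ∈ C, ¬ (kempeGraph G τ x y).Adj v z),
    sum_filter_split (restComps G v τ x y) _ (fun C => ∀ z ∈ C, ¬ (kempeGraph G σ x y).Adj v z)]
  unfold sideTerm
  rw [← restComps_congr G h.off x y]
  have e1 : (restComps G v σ x y).filter (fun C => (∀ z ∈ C, ¬ (kempeGraph G σ x y).Adj v z) ∧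
      ∀ z ∈ C, ¬ (kempeGraph G τ x y).Adj v z) = commonComps G v σ τ x y := by
    refine filter_congr fun C _ => ?_
    rw [← forall₂_and]
  have e2 : (restComps G v σ x y).filter (fun C => (∀ z ∈ C, ¬ (kempeGraph G τ x y).Adj v z) ∧
      ∀ z ∈ C, ¬ (kempeGraph G σ x y).Adj v z) = commonComps G v σ τ x y := by
    rw [← e1]
    exact filter_congr fun C _ => and_comm
  have e3 : (restComps G v σ x y).filter (fun C => (∀ z ∈ C, ¬ (kempeGraph G σ x y).Adj v z) ∧
      ¬ ∀ z ∈ C, ¬ (kempeGraph G τ x y).Adj v z) = (restComps G v σ x y).filter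
      (fun C => (∃ z ∈ C, (kempeGraph G τ x y).Adj v z) ∧
        ∀ z ∈ C, ¬ (kempeGraph G σ x y).Adj v z) := by
    refine filter_congr fun C _ => ?_
    push Not
    exact and_comm
  have e4 : (restComps G v σ x y).filter (fun C => (∀ z ∈ C, ¬ (kempeGraph G τ x y).Adj v z) ∧
      ¬ ∀ z ∈ C, ¬ (kempeGraph G σ x y).Adj v z) = (restComps G v σ x y).filter
      (fun C => (∃ z ∈ C, (kempeGraph G σ x y).Adj v z) ∧
        ∀ z ∈ C, ¬ (kempeGraph G τ x y).Adj v z) := by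
    refine filter_congr fun C _ => ?_
    push Not
    exact and_comm
  rw [e1, e2, e3, e4]
  have e5 : ∑ C ∈ commonComps G v σ τ x y, moveRate L x y C σ *
      ((f (kempeFlip x y C σ) - f (kempeFlip x y C τ)) - (f σ - f τ)) =
      ∑ C ∈ commonComps G v σ τ x y, moveRate L x y C σ * (f (kempeFlip x y C σ) - f σ) -
        ∑ C ∈ commonComps G v σ τ x y, moveRate L x y C τ * (f (kempeFlip x y C τ) - f τ) := by
    rw [← sum_sub_distrib]
    refine sum_congr rfl fun C hC => ?_
    rw [moveRate_congr L x y (σ := τ) (τ := σ) (S := C)]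
    · ring
    · intro z hz
      exact (h.off z fun e => notMem_of_mem_restComps (mem_filter.1 hC).1 (e ▸ hz)).symm
  have e6 : ∀ B : Finset (Finset V),
      ∑ C ∈ B, moveRate L x y C τ * (f τ - f (kempeFlip x y C τ)) =
        - ∑ C ∈ B, moveRate L x y C τ * (f (kempeFlip x y C τ) - f τ) := fun B => by
    rw [← sum_neg_distrib]
    exact sum_congr rfl fun C _ => by ring
  have e7 : ∀ B : Finset (Finset V),
      ∑ C ∈ B, moveRate L x y C σ * (- f σ - - f (kempeFlip x y C σ)) =
        ∑ C ∈ B, moveRate L x y C σ * (f (kempeFlip x y C σ) - f σ) := fun B =>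
    sum_congr rfl fun C _ => by ring
  rw [e5, e6, e7]
  split_ifs <;> ring

lemma sideTerm_comm (G : SimpleGraph V) (L : V → Finset (Fin q)) (v : V)
    (f : (V → Fin q) → ℝ) (σ τ : V → Fin q) (x y : Fin q) :
    sideTerm G L v f σ τ x y = sideTerm G L v f σ τ y x := by
  have e : restComps G v σ x y = restComps G v σ y x := by
    unfold restComps
    rw [restComp_comm]
    simp only [or_comm]
  simp only [sideTerm, kempeGraph_comm G _ x y, moveRate_comm L x y, kempeFlip_comm x y, e,
    or_comm]

lemma sideTerm_self (G : SimpleGraph V) (L : V → Finset (Fin q)) (v : V)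
    (f : (V → Fin q) → ℝ) (σ τ : V → Fin q) (x : Fin q) : sideTerm G L v f σ τ x x = 0 := by
  have e : ∀ (S : Finset V) (ρ : V → Fin q), kempeFlip x x S ρ = ρ := by
    intro S ρ
    funext z
    simp [kempeFlip]
  simp [sideTerm, e]

lemma sideTerm_eq_zero (G : SimpleGraph V) (L : V → Finset (Fin q)) {v : V}
    (f : (V → Fin q) → ℝ) {σ : V → Fin q} (τ : V → Fin q) {x y : Fin q} (hx : σ v ≠ x)
    (hy : σ v ≠ y) : sideTerm G L v f σ τ x y = 0 := by
  have e : ∀ z, ¬ (kempeGraph G σ x y).Adj v z := by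
    rintro z ⟨-, h | h⟩
    exacts [hx h.1, hy h.1]
  simp [sideTerm, e, hx, hy]

lemma sum_sum_eq_two_mul {ι : Type*} [Fintype ι] [DecidableEq ι] (a : ι) (g : ι → ι → ℝ)
    (hcomm : ∀ x y, g x y = g y x) (hself : ∀ x, g x x = 0)
    (hzero : ∀ x y, a ≠ x → a ≠ y → g x y = 0) :
    ∑ x, ∑ y, g x y = 2 * ∑ c ∈ univ.erase a, g a c := by
  have h1 : ∑ y, g a y = ∑ c ∈ univ.erase a, g a c := by
    rw [← add_sum_erase univ _ (mem_univ a), hself, zero_add]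
  have h2 : ∀ x ∈ univ.erase a, ∑ y, g x y = g a x := by
    intro x hx
    rw [Fintype.sum_eq_single a]
    · exact hcomm x a
    · intro y hy
      exact hzero x y (ne_of_mem_erase hx).symm hy.symm
  rw [← add_sum_erase univ _ (mem_univ a), h1, sum_congr rfl h2]
  ring

lemma graphComp_kempeGraph_center (G : SimpleGraph V) (v : V) (σ : V → Fin q) {c : Fin q}
    (hc : c ≠ σ v) :
    graphComp (kempeGraph G σ (σ v) c) v =
      insert v ((colorNbrs G v σ c).biUnion (restComp G v σ (σ v) c)) := by
  rw [graphComp_center]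
  congr 1
  ext z
  simp only [mem_biUnion, mem_filter, mem_univ, true_and, colorNbrs, kempeGraph, restComp]
  refine exists_congr fun w => and_congr_left fun _ => and_congr_right fun _ => ?_
  simp [hc.symm]

lemma filter_attached_restComps (G : SimpleGraph V) (v : V) (σ : V → Fin q) {c : Fin q}
    (hc : c ≠ σ v) (P : Finset V → Prop) [DecidablePred P] :
    (restComps G v σ (σ v) c).filter (fun C =>
      (∃ z ∈ C, (kempeGraph G σ (σ v) c).Adj v z) ∧ P C) =
      ((colorNbrs G v σ c).image (restComp G v σ (σ v) c)).filter P := by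
  rw [← filter_filter]
  congr 1
  ext C
  simp only [mem_filter, mem_image, colorNbrs, mem_univ, true_and]
  constructor
  · rintro ⟨hC, z, hz, hvz, h | h⟩
    · exact ⟨z, ⟨hvz, h.2⟩, (eq_restComp_of_mem hC hz).symm⟩
    · exact absurd h.1.symm hc
  · rintro ⟨w, ⟨hvw, hw⟩, rfl⟩
    refine ⟨?_, w, self_mem_restComp G v σ _ c w, hvw, Or.inl ⟨rfl, hw⟩⟩
    exact mem_image_of_mem _ (mem_filter.2 ⟨mem_univ _, hvw.ne', Or.inr hw⟩)

/-- The vertices other than `v` whose color `a` or `b` blocks a neighbor `w` of `v`. -/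
noncomputable def blockers (G : SimpleGraph V) (v : V) (σ : V → Fin q) (a b : Fin q) (w : V) :
    Finset V :=
  univ.filter fun z => G.Adj w z ∧ z ≠ v ∧ (σ z = a ∨ σ z = b)

/-- The weight of a neighbor `w` of `v` in the bound on the drift. -/
noncomputable def nbrWeight (G : SimpleGraph V) (L : V → Finset (Fin q)) (v : V)
    (σ : V → Fin q) (a b : Fin q) (w : V) : ℝ :=
  if blockers G v σ a b w = ∅ then 11 / 6 - 1 / 20
  else if ∃ z, blockers G v σ a b w = {z} ∧ 2 ≤ (L z).card then 11 / 6 + 1 / 10000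
  else 11 / 6 - 2 / 10000

lemma blockers_symm (G : SimpleGraph V) {v : V} {σ τ : V → Fin q} (h : DifferAt v σ τ)
    (a b : Fin q) (w : V) : blockers G v τ b a w = blockers G v σ a b w := by
  refine filter_congr fun z _ => and_congr_right fun _ => and_congr_right fun hz => ?_
  rw [h.off z hz, or_comm]

lemma le_nbrWeight (G : SimpleGraph V) (L : V → Finset (Fin q)) (v : V)
    (σ : V → Fin q) (a b : Fin q) (w : V) : 11 / 6 - 1 / 20 ≤ nbrWeight G L v σ a b w := by
  unfold nbrWeight
  split_ifs <;> norm_num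

lemma le_nbrWeight_of_ne {G : SimpleGraph V} (L : V → Finset (Fin q)) {v : V}
    {σ : V → Fin q} {a b : Fin q} {w : V} (hw : blockers G v σ a b w ≠ ∅) :
    11 / 6 - 2 / 10000 ≤ nbrWeight G L v σ a b w := by
  rw [nbrWeight, if_neg hw]
  split_ifs <;> norm_num

lemma nbrWeight_of_eq_singleton {G : SimpleGraph V} {L : V → Finset (Fin q)} {v : V}
    {σ : V → Fin q} {a b : Fin q} {w z : V} (hw : blockers G v σ a b w = {z})
    (hz : 2 ≤ (L z).card) : nbrWeight G L v σ a b w = 11 / 6 + 1 / 10000 := by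
  unfold nbrWeight
  rw [if_neg (by rw [hw]; exact singleton_ne_empty z), if_pos ⟨z, hw, hz⟩]

lemma mem_restComp_of_adj {G : SimpleGraph V} {v : V} {σ : V → Fin q} {a c : Fin q} {w z : V}
    (hw : w ≠ v) (hwc : σ w = c) (hwz : G.Adj w z) (hz : z ≠ v) (hza : σ z = a) :
    z ∈ restComp G v σ a c w :=
  mem_graphComp_of_adj (self_mem_restComp G v σ a c w) ⟨⟨hwz, Or.inr ⟨hwc, hza⟩⟩, hw, hz⟩

lemma weightData {G : SimpleGraph V} {L : V → Finset (Fin q)} {v : V} {σ τ : V → Fin q}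
    (h : DifferAt v σ τ) (hσ : ∀ z, σ z ∈ L z) {c : Fin q} (hcσ : c ≠ σ v) (W : V → ℝ)
    (hW : ∀ w, W w = nbrWeight G L v σ (σ v) (τ v) w) :
    WeightData (colorNbrs G v σ c) (restComp G v σ (σ v) c) (restComp G v τ (τ v) c)
      (fun z => Equiv.swap (σ v) c (σ z) ∈ L z) W := by
  have hblocked : ∀ w ∈ colorNbrs G v σ c, (restComp G v σ (σ v) c w).card ≠ 1 →
      blockers G v σ (σ v) (τ v) w ≠ ∅ := by
    intro w hw hne hemp
    obtain ⟨hvw, hwc⟩ := (mem_filter.1 hw).2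
    refine hne (card_eq_one.2 ⟨w, subset_antisymm ?_ ?_⟩)
    · refine graphComp_subset_of_closed (mem_singleton_self w) fun y hy z hyz => ?_
      rw [mem_singleton.1 hy] at hyz
      obtain ⟨⟨hadj, hcol⟩, -, hzv⟩ := hyz
      have hza : σ z = σ v := by
        rcases hcol with h1 | h1
        · exact absurd (hwc.symm.trans h1.1) hcσ
        · exact h1.2
      have : z ∈ blockers G v σ (σ v) (τ v) w :=
        mem_filter.2 ⟨mem_univ _, hadj, hzv, Or.inl hza⟩
      rw [hemp] at this
      exact absurd this (notMem_empty z)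
    · exact singleton_subset_iff.2 (self_mem_restComp G v σ _ c w)
  refine ⟨fun w _ => hW w ▸ le_nbrWeight G L v σ _ _ w,
    fun w hw hne => hW w ▸ le_nbrWeight_of_ne L (hblocked w hw hne), fun w hw h2 h1 hok => ?_⟩
  obtain ⟨hvw, hwc⟩ := (mem_filter.1 hw).2
  have hwv : w ≠ v := hvw.ne'
  obtain ⟨z, hz⟩ := nonempty_iff_ne_empty.2 (hblocked w hw (by omega))
  have hmem : ∀ z' ∈ blockers G v σ (σ v) (τ v) w,
      z' ≠ w ∧ z' ∈ restComp G v σ (σ v) c w ∧ σ z' = σ v := by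
    intro z' hz'
    obtain ⟨hadj, hzv, hcol⟩ := (mem_filter.1 hz').2
    rcases hcol with hcol | hcol
    · exact ⟨hadj.ne', mem_restComp_of_adj hwv hwc hadj hzv hcol, hcol⟩
    · have hz1 : z' ∈ restComp G v τ (τ v) c w := mem_restComp_of_adj hwv
        ((h.off w hwv).symm.trans hwc) hadj hzv ((h.off z' hzv).symm.trans hcol)
      obtain ⟨y, hy⟩ := card_eq_one.1 h1
      have hw1 := self_mem_restComp G v τ (τ v) c w
      rw [hy, mem_singleton] at hz1 hw1
      exact absurd (hz1.trans hw1.symm) hadj.ne'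
  have hz' := hmem z hz
  have hsing : blockers G v σ (σ v) (τ v) w = {z} := by
    refine eq_singleton_iff_unique_mem.2 ⟨hz, fun z' hz1 => ?_⟩
    by_contra hne
    have h3 : ({w, z, z'} : Finset V).card ≤ (restComp G v σ (σ v) c w).card := by
      refine card_le_card fun y hy => ?_
      simp only [mem_insert, mem_singleton] at hy
      rcases hy with rfl | rfl | rfl
      exacts [self_mem_restComp G v σ _ c _, hz'.2.1, (hmem _ hz1).2.1]
    rw [card_eq_three.2 ⟨w, z, z', hz'.1.symm, (hmem z' hz1).1.symm, Ne.symm hne, rfl⟩] at h3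
    omega
  have hL : 2 ≤ (L z).card := by
    have h3 := hok z hz'.2.1
    rw [hz'.2.2, Equiv.swap_apply_left] at h3
    have h4 := hσ z
    rw [hz'.2.2] at h4
    exact one_lt_card.2 ⟨c, h3, σ v, h4, hcσ⟩
  rw [hW, nbrWeight_of_eq_singleton hsing hL]

end Coupling

section SideDrift

variable {V : Type*} [Fintype V] {q : ℕ}

lemma moveRate_eq_okRate (L : V → Finset (Fin q)) (x y : Fin q) (S : Finset V)
    (σ : V → Fin q) :
    moveRate L x y S σ = okRate (fun z => Equiv.swap x y (σ z) ∈ L z) S := by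
  unfold moveRate okRate
  congr

lemma ne_of_mem_colorNbrs {G : SimpleGraph V} {v : V} {σ : V → Fin q} {c : Fin q} {w : V}
    (hw : w ∈ colorNbrs G v σ c) : w ≠ v := (mem_filter.1 hw).2.1.ne'

lemma colorNbrs_congr (G : SimpleGraph V) {v : V} {σ τ : V → Fin q} (h : DifferAt v σ τ)
    (c : Fin q) : colorNbrs G v τ c = colorNbrs G v σ c :=
  filter_congr fun w _ => and_congr_right fun hw => by rw [h.off w hw.ne']

lemma restComp_eq_or_disjoint (G : SimpleGraph V) (v : V) (σ : V → Fin q) (x y : Fin q)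
    (w w' : V) : restComp G v σ x y w = restComp G v σ x y w' ∨
      Disjoint (restComp G v σ x y w) (restComp G v σ x y w') :=
  graphComp_eq_or_disjoint _ _ _

variable {G : SimpleGraph V} {L : V → Finset (Fin q)} {f : (V → Fin q) → ℝ} {v : V}
  {σ τ : V → Fin q} {u : ℝ}

lemma mergeData_of_differAt (hf : HammingLip f) (h : DifferAt v σ τ) (hF : f σ - f τ = 1 - u)
    (c : Fin q) :
    MergeData (colorNbrs G v σ c) v (restComp G v σ (σ v) c) u
      (f (kempeFlip (σ v) c
        (insert v ((colorNbrs G v σ c).biUnion (restComp G v σ (σ v) c))) σ) - f σ)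
      (fun C => f τ - f (kempeFlip (σ v) c C τ)) := by
  refine ⟨fun w _ => self_mem_restComp G v σ _ c w,
    fun w hw hv => ne_of_mem_restComp (ne_of_mem_colorNbrs hw) hv rfl,
    fun w _ w' _ => restComp_eq_or_disjoint G v σ _ c w w',
    fun w _ => hf.self_sub_flip_le _ _ _, ?_, fun w hw => ?_⟩
  · have := hf.flip_sub_le h (mem_insert_self v ((colorNbrs G v σ c).biUnion
      (restComp G v σ (σ v) c))) (σ v) c
    linarith
  · have := hf.flip_sub_flip_le h (mem_insert_self v ((colorNbrs G v σ c).biUnion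
      (restComp G v σ (σ v) c)))
      ((subset_biUnion_of_mem (restComp G v σ (σ v) c) hw).trans (subset_insert _ _))
      (fun hv => ne_of_mem_restComp (ne_of_mem_colorNbrs hw) hv rfl) (σ v) c
    linarith

lemma sum_moveRate_congr (h : DifferAt v σ τ) {B : Finset (Finset V)} (hB : ∀ C ∈ B, v ∉ C)
    (x y : Fin q) (g : Finset V → ℝ) :
    ∑ C ∈ B, moveRate L x y C τ * g C =
      ∑ C ∈ B, okRate (fun z => Equiv.swap x y (σ z) ∈ L z) C * g C := by
  refine sum_congr rfl fun C hC => ?_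
  rw [← moveRate_eq_okRate, moveRate_congr L x y (σ := τ) (τ := σ)]
  exact fun z hz => (h.off z fun e => hB C hC (e ▸ hz)).symm

lemma notMem_of_mem_image_colorNbrs {c x y : Fin q} {C : Finset V}
    (hC : C ∈ (colorNbrs G v σ c).image (restComp G v σ x y)) : v ∉ C := by
  obtain ⟨w, hw, rfl⟩ := mem_image.1 hC
  exact fun hv => ne_of_mem_restComp (ne_of_mem_colorNbrs hw) hv rfl

lemma sideTerm_eq_mergeSum (h : DifferAt v σ τ) {c : Fin q} (hcσ : c ≠ σ v) (hcτ : c ≠ τ v) :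
    sideTerm G L v f σ τ (σ v) c =
      mergeSum (colorNbrs G v σ c) v (restComp G v σ (σ v) c)
        (fun z => Equiv.swap (σ v) c (σ z) ∈ L z)
        (f (kempeFlip (σ v) c
          (insert v ((colorNbrs G v σ c).biUnion (restComp G v σ (σ v) c))) σ) - f σ)
        (fun C => f τ - f (kempeFlip (σ v) c C τ)) := by
  have hno : ∀ C : Finset V, (∀ z ∈ C, ¬ (kempeGraph G τ (σ v) c).Adj v z) := by
    rintro C z - ⟨-, h1 | h1⟩
    exacts [h.ne h1.1.symm, hcτ h1.1.symm]
  rw [sideTerm, filter_attached_restComps G v σ hcσ, graphComp_kempeGraph_center G v σ hcσ,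
    filter_true_of_mem fun C _ => hno C, if_pos (Or.inl rfl),
    sum_moveRate_congr h fun C hC => notMem_of_mem_image_colorNbrs hC, moveRate_eq_okRate]
  rfl

lemma sideTerm_add_sideTerm_le (hf : HammingLip f) (h : DifferAt v σ τ) (hσ : ∀ z, σ z ∈ L z)
    (hτ : ∀ z, τ z ∈ L z) (hF : f σ - f τ = 1 - u) (hu : 0 ≤ u) (hu1 : u ≤ 1) {c : Fin q}
    (hcσ : c ≠ σ v) (hcτ : c ≠ τ v) :
    sideTerm G L v f σ τ (σ v) c + sideTerm G L v (fun ρ => - f ρ) τ σ (τ v) c +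
      (if c ∈ L v then 1 - u else 0) ≤
      ∑ w ∈ colorNbrs G v σ c, nbrWeight G L v σ (σ v) (τ v) w +
        4 * u * (colorNbrs G v σ c).card := by
  rw [sideTerm_eq_mergeSum h hcσ hcτ, sideTerm_eq_mergeSum h.symm hcτ hcσ]
  have hF' : (fun ρ => - f ρ) τ - (fun ρ => - f ρ) σ = 1 - u := by
    simp only
    linarith
  have hm := mergeData_of_differAt (G := G) hf h hF c
  have hm' := mergeData_of_differAt (G := G) hf.neg h.symm hF' c
  have hW := weightData (G := G) (L := L) h hσ hcσ _ (fun w => rfl)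
  have hW' := weightData (G := G) (L := L) h.symm hτ hcτ (nbrWeight G L v σ (σ v) (τ v))
    (fun w => by simp only [nbrWeight, blockers_symm G h])
  rw [colorNbrs_congr G h c] at hm' hW' ⊢
  refine mergeSum_add_le hm hm' hu hu1 (fun w hw => ?_) ?_ ?_ ?_ hW hW'
  · have := hf.flip_sub_flip_of_common_le h (self_mem_restComp G v σ (σ v) c w)
      (self_mem_restComp G v τ (τ v) c w) (σ v) c (τ v) c
    linarith
  · have := hf.flip_sub_flip_of_center_le h
      (T := insert v ((colorNbrs G v σ c).biUnion (restComp G v σ (σ v) c)))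
      (T' := insert v ((colorNbrs G v σ c).biUnion (restComp G v τ (τ v) c)))
      (N := colorNbrs G v σ c) (mem_insert_self _ _) (mem_insert_self _ _)
      (fun w hw => mem_insert_of_mem
        (mem_biUnion.2 ⟨w, hw, self_mem_restComp G v σ (σ v) c w⟩))
      (fun w hw => mem_insert_of_mem
        (mem_biUnion.2 ⟨w, hw, self_mem_restComp G v τ (τ v) c w⟩))
      (fun hv => ne_of_mem_colorNbrs hv rfl) c
    linarith
  · rw [Equiv.swap_apply_left]
  · rw [Equiv.swap_apply_left]

lemma sideTerm_center_le (hf : HammingLip f) (h : DifferAt v σ τ) (hτ : ∀ z, τ z ∈ L z)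
    (hF : f σ - f τ = 1 - u) (hu : 0 ≤ u) :
    sideTerm G L v f σ τ (σ v) (τ v) + (1 - u) ≤
      ∑ w ∈ colorNbrs G v σ (τ v), nbrWeight G L v σ (σ v) (τ v) w +
        4 * u * (colorNbrs G v σ (τ v)).card := by
  rw [sideTerm, filter_attached_restComps G v σ h.ne.symm,
    graphComp_kempeGraph_center G v σ h.ne.symm, if_pos (Or.inl rfl),
    sum_moveRate_congr h fun C hC => notMem_of_mem_image_colorNbrs (mem_filter.1 hC).1,
    moveRate_eq_okRate]
  refine half_merge_le (R := restComp G v σ (σ v) (τ v))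
    (x := fun C => f τ - f (kempeFlip (σ v) (τ v) C τ)) _ hu
    (fun w _ => self_mem_restComp G v σ _ _ w)
    (fun w hw hv => ne_of_mem_restComp (ne_of_mem_colorNbrs hw) hv rfl)
    (fun w _ => hf.self_sub_flip_le _ _ _) ?_ (fun w hw => ?_) ?_
    (fun w _ => le_nbrWeight G L v σ _ _ w)
  · have := hf.flip_center_sub_le h (mem_insert_self v ((colorNbrs G v σ (τ v)).biUnion
      (restComp G v σ (σ v) (τ v))))
    linarith
  · have := hf.flip_center_sub_flip_le h (mem_insert_self v ((colorNbrs G v σ (τ v)).biUnion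
      (restComp G v σ (σ v) (τ v))))
      ((subset_biUnion_of_mem (restComp G v σ (σ v) (τ v)) hw).trans (subset_insert _ _))
      (fun hv => ne_of_mem_restComp (ne_of_mem_colorNbrs hw) hv rfl)
    linarith
  · rw [Equiv.swap_apply_left]
    exact hτ v

/-- The total contribution of the components meeting `v` to the drift. -/
lemma sum_sideTerm_le (hf : HammingLip f) (h : DifferAt v σ τ) (hσ : ∀ z, σ z ∈ L z)
    (hτ : ∀ z, τ z ∈ L z) (hF : f σ - f τ = 1 - u) (hu : 0 ≤ u) (hu1 : u ≤ 1) :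
    ∑ x, ∑ y, (sideTerm G L v f σ τ x y + sideTerm G L v (fun ρ => - f ρ) τ σ x y) ≤
      2 * (∑ w ∈ univ.filter (G.Adj v), nbrWeight G L v σ (σ v) (τ v) w +
        4 * u * (univ.filter (G.Adj v)).card - (1 - u) * (L v).card) := by
  set W := nbrWeight G L v σ (σ v) (τ v) with hWdef
  have hF' : (fun ρ => - f ρ) τ - (fun ρ => - f ρ) σ = 1 - u := by
    simp only
    linarith
  have e1 := sum_sum_eq_two_mul (σ v) (fun x y => sideTerm G L v f σ τ x y)
    (sideTerm_comm G L v f σ τ) (sideTerm_self G L v f σ τ)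
    (fun x y hx hy => sideTerm_eq_zero G L f τ hx hy)
  have e2 := sum_sum_eq_two_mul (τ v) (fun x y => sideTerm G L v (fun ρ => - f ρ) τ σ x y)
    (sideTerm_comm G L v _ τ σ) (sideTerm_self G L v _ τ σ)
    (fun x y hx hy => sideTerm_eq_zero G L _ σ hx hy)
  have hτσ : τ v ∈ univ.erase (σ v) := mem_erase.2 ⟨h.ne.symm, mem_univ _⟩
  have hστ : σ v ∈ univ.erase (τ v) := mem_erase.2 ⟨h.ne, mem_univ _⟩
  rw [← add_sum_erase _ _ hτσ] at e1
  rw [← add_sum_erase _ _ hστ, erase_right_comm] at e2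
  simp only [sum_add_distrib]
  rw [e1, e2]
  have b1 := sideTerm_center_le (G := G) (L := L) hf h hτ hF hu
  have b2 := sideTerm_center_le (G := G) (L := L) hf.neg h.symm hσ hF' hu
  rw [colorNbrs_congr G h] at b2
  have eW : nbrWeight G L v τ (τ v) (σ v) = W := by
    funext w
    simp only [hWdef, nbrWeight, blockers_symm G h]
  rw [eW] at b2
  rw [← hWdef] at b1
  have b3 : ∑ c ∈ (univ.erase (σ v)).erase (τ v), (sideTerm G L v f σ τ (σ v) c +
      sideTerm G L v (fun ρ => - f ρ) τ σ (τ v) c + (if c ∈ L v then 1 - u else 0)) ≤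
      ∑ c ∈ (univ.erase (σ v)).erase (τ v), (∑ w ∈ colorNbrs G v σ c, W w +
        4 * u * (colorNbrs G v σ c).card) := by
    refine sum_le_sum fun c hc => ?_
    rw [mem_erase, mem_erase] at hc
    exact sideTerm_add_sideTerm_le hf h hσ hτ hF hu hu1 hc.2.1 hc.1
  simp only [sum_add_distrib] at b3
  have s1 : ∑ c, (if c ∈ L v then 1 - u else 0) = (1 - u) * (L v).card := by
    rw [sum_ite_mem, univ_inter, sum_const, nsmul_eq_mul, mul_comm]
  have s2 : ∑ c, ∑ w ∈ colorNbrs G v σ c, W w = ∑ w ∈ univ.filter (G.Adj v), W w := by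
    rw [← sum_fiberwise (univ.filter (G.Adj v)) σ W]
    refine sum_congr rfl fun c _ => ?_
    rw [filter_filter]
    rfl
  have s3 : ∑ c, 4 * u * ((colorNbrs G v σ c).card : ℝ) =
      4 * u * ((univ.filter (G.Adj v)).card : ℝ) := by
    rw [← mul_sum, card_eq_sum_card_fiberwise (f := σ) (t := univ) (fun _ _ => mem_univ _)]
    push_cast
    congr 1
    refine sum_congr rfl fun c _ => ?_
    rw [filter_filter]
    rfl
  rw [← add_sum_erase _ _ (mem_univ (σ v)), ← add_sum_erase _ _ hτσ] at s1 s2 s3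
  rw [if_pos (hσ v), if_pos (hτ v)] at s1
  linarith

end SideDrift

section CommonDrift

variable {V : Type*} [Fintype V] {q : ℕ}

/-- The indicator that `w` is not blocked by the colors `a` and `b`. -/
noncomputable def freeInd (G : SimpleGraph V) (v : V) (σ : V → Fin q) (a b : Fin q) (w : V) : ℝ :=
  if blockers G v σ a b w = ∅ then 1 else 0

/-- The number of neighbors of `v` that are not blocked by the colors `a` and `b`. -/
noncomputable def freeCount (G : SimpleGraph V) (v : V) (σ : V → Fin q) (a b : Fin q) : ℝ :=
  ∑ w ∈ univ.filter (G.Adj v), freeInd G v σ a b w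

/-- The number of neighbors of `v` with exactly one blocker, which moreover is not frozen. -/
noncomputable def loneCount (G : SimpleGraph V) (L : V → Finset (Fin q)) (v : V)
    (σ : V → Fin q) (a b : Fin q) : ℝ :=
  ((univ.filter (G.Adj v)).filter fun w =>
    ∃ z, blockers G v σ a b w = {z} ∧ 2 ≤ (L z).card).card

lemma freeInd_nonneg (G : SimpleGraph V) (v : V) (σ : V → Fin q) (a b : Fin q) (w : V) :
    0 ≤ freeInd G v σ a b w := by
  unfold freeInd
  split_ifs <;> norm_num

lemma freeInd_le_one (G : SimpleGraph V) (v : V) (σ : V → Fin q) (a b : Fin q) (w : V) :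
    freeInd G v σ a b w ≤ 1 := by
  unfold freeInd
  split_ifs <;> norm_num

lemma DifferAt.kempeFlip {v : V} {σ τ : V → Fin q} (h : DifferAt v σ τ) {C : Finset V}
    (hv : v ∉ C) (x y : Fin q) : DifferAt v (kempeFlip x y C σ) (kempeFlip x y C τ) :=
  ⟨fun w hw => by simp only [_root_.kempeFlip, h.off w hw],
    by simpa only [_root_.kempeFlip, if_neg hv] using h.ne⟩

lemma kempeFlip_mem {L : V → Finset (Fin q)} {x y : Fin q} {C : Finset V} {σ : V → Fin q}
    (hσ : ∀ z, σ z ∈ L z) (h : moveRate L x y C σ ≠ 0) (z : V) :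
    kempeFlip x y C σ z ∈ L z := by
  unfold kempeFlip
  split_ifs with hz
  · by_contra hz'
    exact h (if_neg fun hall => hz' (hall z hz))
  · exact hσ z

lemma sum_ite_mem_moveRate_le_one {G : SimpleGraph V} (L : V → Finset (Fin q)) {v : V}
    {σ : V → Fin q} {x y : Fin q} {B : Finset (Finset V)} (hB : B ⊆ restComps G v σ x y) (z : V) :
    ∑ C ∈ B, (if z ∈ C then moveRate L x y C σ else 0) ≤ 1 := by
  rw [← sum_filter]
  have hsub : B.filter (fun C => z ∈ C) ⊆ {restComp G v σ x y z} := fun C hC => by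
    rw [mem_filter] at hC
    exact mem_singleton.2 (eq_restComp_of_mem (hB hC.1) hC.2)
  refine (sum_le_sum_of_subset_of_nonneg hsub fun C _ _ => moveRate_nonneg L x y C σ).trans ?_
  rw [sum_singleton]
  exact moveRate_le_one _ _ _ _ _

lemma sum_sum_swap_le_four {s a b : Fin q} (ha : s ≠ a) (hb : s ≠ b) :
    ∑ x, ∑ y, (if Equiv.swap x y s = a ∨ Equiv.swap x y s = b then (1 : ℝ) else 0) ≤ 4 := by
  have hle : ∀ x y : Fin q,
      (if Equiv.swap x y s = a ∨ Equiv.swap x y s = b then (1 : ℝ) else 0) ≤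
        (if x = s then if y = a then 1 else 0 else 0) +
          (if x = a then if y = s then 1 else 0 else 0)
        + ((if x = s then if y = b then 1 else 0 else 0) +
          (if x = b then if y = s then 1 else 0 else 0)) := by
    intro x y
    by_cases hx : x = s
    · subst hx
      rw [Equiv.swap_apply_left]
      split_ifs <;> simp_all
    · by_cases hy : y = s
      · subst hy
        rw [Equiv.swap_apply_right]
        split_ifs <;> simp_all
      · rw [Equiv.swap_apply_of_ne_of_ne (Ne.symm hx) (Ne.symm hy), if_neg (by tauto)]
        simp [hx, hy]
  refine (sum_le_sum fun x _ => sum_le_sum fun y _ => hle x y).trans (le_of_eq ?_)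
  simp only [sum_add_distrib, sum_ite_irrel, sum_ite_eq', mem_univ, if_true, sum_const_zero]
  norm_num

variable {G : SimpleGraph V} {L : V → Finset (Fin q)} {v : V} {σ τ : V → Fin q}

/-- Upon a random move of a common component, a free neighbor `w` of `v` stays free except with
rate `4` for each neighbor of `w`. -/
lemma sum_freeInd_loss_le {a b : Fin q} {w : V} (hw : blockers G v σ a b w = ∅)
    {B : Fin q → Fin q → Finset (Finset V)} (hB : ∀ x y, B x y ⊆ restComps G v σ x y) :
    ∑ x, ∑ y, ∑ C ∈ B x y, moveRate L x y C σ *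
        (freeInd G v σ a b w - freeInd G v (kempeFlip x y C σ) a b w) ≤
      4 * (univ.filter (G.Adj w)).card := by
  set Z := (univ.filter (G.Adj w)).erase v with hZ
  have hcol : ∀ z ∈ Z, σ z ≠ a ∧ σ z ≠ b := by
    intro z hz
    rw [hZ, mem_erase, mem_filter] at hz
    by_contra hcon
    have : z ∈ blockers G v σ a b w := mem_filter.2 ⟨mem_univ _, hz.2.2, hz.1, by tauto⟩
    rw [hw] at this
    exact notMem_empty _ this
  have h1 : ∀ x y, ∀ C ∈ B x y, moveRate L x y C σ *
      (freeInd G v σ a b w - freeInd G v (kempeFlip x y C σ) a b w) ≤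
      ∑ z ∈ Z, (if Equiv.swap x y (σ z) = a ∨ Equiv.swap x y (σ z) = b then (1 : ℝ) else 0) *
        (if z ∈ C then moveRate L x y C σ else 0) := by
    intro x y C _
    have hnn : ∀ z ∈ Z, 0 ≤
        (if Equiv.swap x y (σ z) = a ∨ Equiv.swap x y (σ z) = b then (1 : ℝ) else 0) *
        (if z ∈ C then moveRate L x y C σ else 0) := fun z _ =>
      mul_nonneg (by split_ifs <;> norm_num)
        (by split_ifs; exacts [moveRate_nonneg _ _ _ _ _, le_rfl])
    by_cases hemp : blockers G v (kempeFlip x y C σ) a b w = ∅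
    · rw [freeInd, freeInd, if_pos hw, if_pos hemp, sub_self, mul_zero]
      exact sum_nonneg hnn
    · obtain ⟨z, hz⟩ := nonempty_iff_ne_empty.2 hemp
      obtain ⟨hadj, hzv, hc⟩ := (mem_filter.1 hz).2
      have hzZ : z ∈ Z := mem_erase.2 ⟨hzv, mem_filter.2 ⟨mem_univ _, hadj⟩⟩
      refine le_trans ?_ (single_le_sum hnn hzZ)
      have hzC : z ∈ C := by
        by_contra hzC
        rw [kempeFlip, if_neg hzC] at hc
        have := hcol z hzZ
        tauto
      rw [kempeFlip, if_pos hzC] at hc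
      rw [freeInd, freeInd, if_pos hw, if_neg hemp, if_pos hc, if_pos hzC]
      linarith
  calc _ ≤ ∑ x, ∑ y, ∑ C ∈ B x y, ∑ z ∈ Z,
        (if Equiv.swap x y (σ z) = a ∨ Equiv.swap x y (σ z) = b then (1 : ℝ) else 0) *
        (if z ∈ C then moveRate L x y C σ else 0) :=
        sum_le_sum fun x _ => sum_le_sum fun y _ => sum_le_sum (h1 x y)
    _ = ∑ z ∈ Z, ∑ x, ∑ y,
        (if Equiv.swap x y (σ z) = a ∨ Equiv.swap x y (σ z) = b then (1 : ℝ) else 0) *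
        ∑ C ∈ B x y, (if z ∈ C then moveRate L x y C σ else 0) := by
        rw [sum_comm]
        simp only [mul_sum]
        rw [sum_comm]
        rw [sum_comm' (s := Z) (t' := univ) (s' := fun _ => Z) (by simp)]
        refine sum_congr rfl fun x _ => ?_
        rw [sum_comm' (s := Z) (t' := univ) (s' := fun _ => Z) (by simp)]
        refine sum_congr rfl fun y _ => ?_
        rw [sum_comm]
    _ ≤ ∑ z ∈ Z, ∑ x, ∑ y,
        (if Equiv.swap x y (σ z) = a ∨ Equiv.swap x y (σ z) = b then (1 : ℝ) else 0) :=
        sum_le_sum fun z _ => sum_le_sum fun x _ => sum_le_sum fun y _ =>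
          mul_le_of_le_one_right (by split_ifs <;> norm_num)
            (sum_ite_mem_moveRate_le_one L (hB x y) z)
    _ ≤ ∑ z ∈ Z, 4 := sum_le_sum fun z hz => sum_sum_swap_le_four (hcol z hz).1 (hcol z hz).2
    _ ≤ 4 * (univ.filter (G.Adj w)).card := by
        rw [sum_const, nsmul_eq_mul, mul_comm]
        gcongr
        exact erase_subset _ _

lemma freeInd_loss_nonpos {a b : Fin q} {w : V} (hw : blockers G v σ a b w ≠ ∅) (x y : Fin q)
    (C : Finset V) : moveRate L x y C σ *
        (freeInd G v σ a b w - freeInd G v (kempeFlip x y C σ) a b w) ≤ 0 := by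
  refine mul_nonpos_of_nonneg_of_nonpos (moveRate_nonneg _ _ _ _ _) ?_
  rw [freeInd, if_neg hw, zero_sub, neg_nonpos]
  exact freeInd_nonneg _ _ _ _ _ _

lemma restComp_eq_singleton {z : V} {c : Fin q} (hc : c ≠ σ z)
    (hN : ∀ y, G.Adj z y → σ y ≠ c) : restComp G v σ (σ z) c z = {z} := by
  refine subset_antisymm (graphComp_subset_of_closed (mem_singleton_self z) fun y hy y' hyy' => ?_)
    (singleton_subset_iff.2 (self_mem_restComp G v σ _ _ z))
  rw [mem_singleton.1 hy] at hyy'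
  obtain ⟨⟨hadj, h1 | h1⟩, -⟩ := hyy'
  · exact absurd h1.2 (hN y' hadj)
  · exact absurd h1.1.symm hc

/-- A neighbor of `v` with a single blocker is freed by recoloring this blocker. -/
lemma sum_freeInd_gain_le (h : DifferAt v σ τ) {w z : V}
    (hw : blockers G v σ (σ v) (τ v) w = {z}) {D : ℕ} (hD : (univ.filter (G.Adj z)).card ≤ D) :
    ∑ x, ∑ y, ∑ C ∈ commonComps G v σ τ x y, moveRate L x y C σ *
        (freeInd G v σ (σ v) (τ v) w - freeInd G v (kempeFlip x y C σ) (σ v) (τ v) w) ≤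
      (D : ℝ) + 2 - (L z).card := by
  have hne : blockers G v σ (σ v) (τ v) w ≠ ∅ := hw ▸ singleton_ne_empty z
  have hnp := freeInd_loss_nonpos (L := L) hne
  obtain ⟨-, hzv, hzc⟩ := (mem_filter.1 (hw ▸ mem_singleton_self z :
    z ∈ blockers G v σ (σ v) (τ v) w)).2
  set T := insert (σ v) (insert (τ v) ((univ.filter (G.Adj z)).image σ)) with hT
  set F := L z \ T with hF
  have hFcard : ((L z).card : ℝ) - D - 2 ≤ F.card := by
    have h1 : (L z).card - T.card ≤ F.card := le_card_sdiff T (L z)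
    have h2 : T.card ≤ _ := card_insert_le (σ v) (insert (τ v) ((univ.filter (G.Adj z)).image σ))
    have h3 := card_insert_le (τ v) ((univ.filter (G.Adj z)).image σ)
    have h4 := card_image_le (s := univ.filter (G.Adj z)) (f := σ)
    have h5 : (L z).card ≤ F.card + D + 2 := by omega
    have h6 : ((L z).card : ℝ) ≤ F.card + D + 2 := by exact_mod_cast h5
    linarith
  have hgain : ∀ c ∈ F, ∑ C ∈ commonComps G v σ τ (σ z) c, moveRate L (σ z) c C σ *
      (freeInd G v σ (σ v) (τ v) w - freeInd G v (kempeFlip (σ z) c C σ) (σ v) (τ v) w) ≤ -1 := by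
    intro c hc
    simp only [hF, hT, mem_sdiff, mem_insert, mem_image, mem_filter, mem_univ, true_and, not_or,
      not_exists, not_and] at hc
    obtain ⟨hcL, hcσ, hcτ, hcN⟩ := hc
    have hcz : c ≠ σ z := by
      rintro rfl
      tauto
    have hsing := restComp_eq_singleton (G := G) (v := v) hcz hcN
    have hmem : {z} ∈ commonComps G v σ τ (σ z) c := by
      refine mem_filter.2 ⟨hsing ▸ mem_image_of_mem _
        (mem_filter.2 ⟨mem_univ _, hzv, Or.inl rfl⟩), fun y hy => ?_⟩
      rw [mem_singleton.1 hy]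
      refine ⟨?_, ?_⟩
      · rintro ⟨-, h1 | h1⟩
        exacts [hcz h1.2.symm, hcσ h1.1.symm]
      · rintro ⟨-, h1 | h1⟩
        · exact hcz (h1.2.symm.trans (h.off z hzv).symm)
        · exact hcτ h1.1.symm
    have hrate : moveRate L (σ z) c {z} σ = 1 := by
      rw [moveRate, if_pos, card_singleton]
      · rfl
      · intro y hy
        rw [mem_singleton.1 hy, Equiv.swap_apply_left]
        exact hcL
    have hfree : blockers G v (kempeFlip (σ z) c {z} σ) (σ v) (τ v) w = ∅ := by
      refine eq_empty_of_forall_notMem fun y hy => ?_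
      obtain ⟨hadj, hyv, hyc⟩ := (mem_filter.1 hy).2
      by_cases hyz : y = z
      · subst hyz
        rw [kempeFlip, if_pos (mem_singleton_self y), Equiv.swap_apply_left] at hyc
        tauto
      · rw [kempeFlip, if_neg (by rwa [mem_singleton])] at hyc
        have : y ∈ blockers G v σ (σ v) (τ v) w := mem_filter.2 ⟨mem_univ _, hadj, hyv, hyc⟩
        rw [hw] at this
        exact hyz (mem_singleton.1 this)
    have e0 : freeInd G v σ (σ v) (τ v) w = 0 := if_neg hne
    have e1 : freeInd G v (kempeFlip (σ z) c {z} σ) (σ v) (τ v) w = 1 := if_pos hfree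
    rw [← add_sum_erase _ _ hmem, hrate, e0, e1]
    rw [e0] at hnp
    have := sum_nonpos (s := (commonComps G v σ τ (σ z) c).erase {z})
      fun C _ => hnp (σ z) c C
    linarith
  have h1 : ∑ y, ∑ C ∈ commonComps G v σ τ (σ z) y, moveRate L (σ z) y C σ *
      (freeInd G v σ (σ v) (τ v) w - freeInd G v (kempeFlip (σ z) y C σ) (σ v) (τ v) w) ≤
      - (F.card : ℝ) := by
    rw [← sum_add_sum_compl F]
    have h2 := sum_le_sum hgain
    have h3 := sum_nonpos (s := Fᶜ) fun y _ => sum_nonpos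
      (s := commonComps G v σ τ (σ z) y) fun C _ => hnp (σ z) y C
    rw [sum_const, nsmul_eq_mul, mul_neg_one] at h2
    linarith
  rw [← add_sum_erase _ _ (mem_univ (σ z))]
  have h2 := sum_nonpos (s := univ.erase (σ z)) fun x _ => sum_nonpos (s := univ) fun y _ =>
    sum_nonpos (s := commonComps G v σ τ x y) fun C _ => hnp x y C
  linarith

/-- The drift of the number of free neighbors of `v` under the moves of common components. -/
lemma sum_freeCount_loss_le (h : DifferAt v σ τ) {D : ℕ} {k : ℝ}
    (hD : ∀ z, (univ.filter (G.Adj z)).card ≤ D)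
    (hk : ∀ z, 2 ≤ (L z).card → k + D + 2 ≤ (L z).card) :
    ∑ x, ∑ y, ∑ C ∈ commonComps G v σ τ x y, moveRate L x y C σ *
        (freeCount G v σ (σ v) (τ v) - freeCount G v (kempeFlip x y C σ) (σ v) (τ v)) ≤
      4 * D * freeCount G v σ (σ v) (τ v) - k * loneCount G L v σ (σ v) (τ v) := by
  have e : ∑ x, ∑ y, ∑ C ∈ commonComps G v σ τ x y, moveRate L x y C σ *
        (freeCount G v σ (σ v) (τ v) - freeCount G v (kempeFlip x y C σ) (σ v) (τ v)) =
      ∑ w ∈ univ.filter (G.Adj v), ∑ x, ∑ y, ∑ C ∈ commonComps G v σ τ x y, moveRate L x y C σ *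
        (freeInd G v σ (σ v) (τ v) w - freeInd G v (kempeFlip x y C σ) (σ v) (τ v) w) := by
    rw [sum_comm (s := univ.filter (G.Adj v))]
    refine sum_congr rfl fun x _ => ?_
    rw [sum_comm (s := univ.filter (G.Adj v))]
    refine sum_congr rfl fun y _ => ?_
    rw [sum_comm (s := univ.filter (G.Adj v))]
    refine sum_congr rfl fun C _ => ?_
    rw [freeCount, freeCount, ← sum_sub_distrib, mul_sum]
  rw [e, freeCount, loneCount, mul_sum, card_filter, Nat.cast_sum, mul_sum, ← sum_sub_distrib]
  refine sum_le_sum fun w _ => ?_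
  by_cases h0 : blockers G v σ (σ v) (τ v) w = ∅
  · have h1 : ¬ ∃ z, blockers G v σ (σ v) (τ v) w = {z} ∧ 2 ≤ (L z).card := by
      rintro ⟨z, hz, -⟩
      exact singleton_ne_empty z (hz.symm.trans h0)
    have h2 := sum_freeInd_loss_le (L := L) h0 (B := commonComps G v σ τ)
      fun x y => filter_subset _ _
    have h3 : (((univ.filter (G.Adj w)).card : ℕ) : ℝ) ≤ D := by exact_mod_cast hD w
    rw [if_neg h1]
    have h4 : freeInd G v σ (σ v) (τ v) w = 1 := if_pos h0
    rw [h4] at h2 ⊢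
    push_cast
    linarith
  · have h4 : freeInd G v σ (σ v) (τ v) w = 0 := if_neg h0
    split_ifs with h1
    · obtain ⟨z, hz, hz2⟩ := h1
      have h2 := sum_freeInd_gain_le (L := L) h hz (hD z)
      have h3 := hk z hz2
      rw [h4] at h2 ⊢
      push_cast
      linarith
    · rw [h4]
      push_cast
      have := sum_nonpos (s := univ) fun x (_ : x ∈ univ) => sum_nonpos (s := univ)
        fun y _ => sum_nonpos (s := commonComps G v σ τ x y)
        fun C _ => freeInd_loss_nonpos (L := L) h0 x y C
      rw [h4] at this
      linarith

end CommonDrift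

section Contraction

variable {V : Type*} [Fintype V] {q : ℕ}

/-- The distance of two colorings that differ exactly at `v` is `1` minus this quantity. -/
noncomputable def slack (G : SimpleGraph V) (D : ℕ) (v : V) (σ τ : V → Fin q) : ℝ :=
  1 / 200 * freeCount G v σ (σ v) (τ v) / D

/-- Lists with at least two colors are large with respect to the degree bound `D`. -/
def LongLists (D : ℕ) (L : V → Finset (Fin q)) : Prop :=
  ∀ z, 2 ≤ (L z).card →
    (11 / 6 - 1 / 10000) * (D : ℝ) ≤ (L z).card ∧ (D : ℝ) + 2 ≤ (L z).card

variable {G : SimpleGraph V} {L : V → Finset (Fin q)} {v : V} {σ τ : V → Fin q} {D : ℕ}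

lemma freeCount_nonneg (a b : Fin q) : 0 ≤ freeCount G v σ a b :=
  sum_nonneg fun _ _ => freeInd_nonneg _ _ _ _ _ _

lemma freeCount_le (hD : ∀ z, (univ.filter (G.Adj z)).card ≤ D) (a b : Fin q) :
    freeCount G v σ a b ≤ D := by
  have h := sum_le_card_nsmul (univ.filter (G.Adj v)) (freeInd G v σ a b) 1
    fun w _ => freeInd_le_one _ _ _ _ _ _
  rw [nsmul_one] at h
  exact h.trans (by exact_mod_cast hD v)

lemma slack_nonneg : 0 ≤ slack G D v σ τ :=
  div_nonneg (mul_nonneg (by norm_num) (freeCount_nonneg _ _)) (Nat.cast_nonneg _)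

lemma slack_mul (hD : ∀ z, (univ.filter (G.Adj z)).card ≤ D) :
    slack G D v σ τ * D = 1 / 200 * freeCount G v σ (σ v) (τ v) := by
  rcases Nat.eq_zero_or_pos D with rfl | h
  · have h1 := freeCount_le (v := v) (σ := σ) hD (σ v) (τ v)
    have h2 := freeCount_nonneg (G := G) (v := v) (σ := σ) (σ v) (τ v)
    rw [Nat.cast_zero] at h1
    rw [le_antisymm h1 h2]
    simp
  · have : (D : ℝ) ≠ 0 := by positivity
    rw [slack, div_mul_cancel₀ _ this]

lemma slack_le_mul : slack G D v σ τ ≤ slack G D v σ τ * D := by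
  rcases Nat.eq_zero_or_pos D with rfl | h
  · simp [slack]
  · have : (1 : ℝ) ≤ D := by exact_mod_cast h
    exact le_mul_of_one_le_right slack_nonneg this

lemma slack_le (hD : ∀ z, (univ.filter (G.Adj z)).card ≤ D) : slack G D v σ τ ≤ 1 / 200 := by
  rcases Nat.eq_zero_or_pos D with rfl | h
  · simp [slack]
  · have h0 : (0 : ℝ) < D := by exact_mod_cast h
    rw [slack, div_le_iff₀ h0]
    have := freeCount_le (v := v) (σ := σ) hD (σ v) (τ v)
    linarith

lemma loneCount_nonneg (a b : Fin q) : 0 ≤ loneCount G L v σ a b := Nat.cast_nonneg _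

lemma sum_nbrWeight (a b : Fin q) :
    ∑ w ∈ univ.filter (G.Adj v), nbrWeight G L v σ a b w =
      (11 / 6 - 2 / 10000) * (univ.filter (G.Adj v)).card -
        (1 / 20 - 2 / 10000) * freeCount G v σ a b + 3 / 10000 * loneCount G L v σ a b := by
  have h : ∀ w, nbrWeight G L v σ a b w = (11 / 6 - 2 / 10000) -
      (1 / 20 - 2 / 10000) * freeInd G v σ a b w + 3 / 10000 *
        (if ∃ z, blockers G v σ a b w = {z} ∧ 2 ≤ (L z).card then 1 else 0) := by
    intro w
    unfold nbrWeight freeInd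
    by_cases h0 : blockers G v σ a b w = ∅
    · have h1 : ¬ ∃ z, blockers G v σ a b w = {z} ∧ 2 ≤ (L z).card := by
        rintro ⟨z, hz, -⟩
        exact singleton_ne_empty z (hz.symm.trans h0)
      rw [if_pos h0, if_pos h0, if_neg h1]
      norm_num
    · rw [if_neg h0, if_neg h0]
      split_ifs <;> norm_num
  have hlone : loneCount G L v σ a b = ∑ w ∈ univ.filter (G.Adj v),
      (if ∃ z, blockers G v σ a b w = {z} ∧ 2 ≤ (L z).card then (1 : ℝ) else 0) := by
    rw [loneCount, card_filter, Nat.cast_sum]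
    simp only [Nat.cast_ite, Nat.cast_one, Nat.cast_zero]
  rw [sum_congr rfl fun w _ => h w, sum_add_distrib, sum_sub_distrib, sum_const, nsmul_eq_mul,
    ← mul_sum, ← mul_sum, ← hlone, freeCount]
  ring

lemma slack_mul_loneCount_le (hL : LongLists D L) (h3 : 3 ≤ D) {z : V} (hz : 2 ≤ (L z).card) :
    (D : ℝ) / 7 + D + 2 ≤ (L z).card := by
  have h3' : (3 : ℝ) ≤ D := by exact_mod_cast h3
  have := (hL z hz).1
  linarith

/-- The moves of the common components do not increase the distance on average by more than
this. -/
lemma common_drift_le {f : (V → Fin q) → ℝ} (h : DifferAt v σ τ) (hσ : ∀ z, σ z ∈ L z)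
    (hτ : ∀ z, τ z ∈ L z) (hD : ∀ z, (univ.filter (G.Adj z)).card ≤ D)
    (hf : ∀ ⦃σ' τ' : V → Fin q⦄, DifferAt v σ' τ' → (∀ z, σ' z ∈ L z) → (∀ z, τ' z ∈ L z) →
      f σ' - f τ' ≤ 1 - slack G D v σ' τ')
    (hF : f σ - f τ = 1 - slack G D v σ τ) {k : ℝ}
    (hk : ∀ z, 2 ≤ (L z).card → k + D + 2 ≤ (L z).card) :
    ∑ x, ∑ y, ∑ C ∈ commonComps G v σ τ x y, moveRate L x y C σ *
        ((f (kempeFlip x y C σ) - f (kempeFlip x y C τ)) - (f σ - f τ)) ≤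
      1 / 200 / D * (4 * D * freeCount G v σ (σ v) (τ v) -
        k * loneCount G L v σ (σ v) (τ v)) := by
  refine le_trans ?_ (mul_le_mul_of_nonneg_left (sum_freeCount_loss_le h hD hk)
    (div_nonneg (by norm_num) (Nat.cast_nonneg D)))
  simp only [mul_sum]
  refine sum_le_sum fun x _ => sum_le_sum fun y _ => sum_le_sum fun C hC => ?_
  have hv : v ∉ C := notMem_of_mem_restComps (mem_filter.1 hC).1
  have hrτ : moveRate L x y C σ = moveRate L x y C τ :=
    moveRate_congr L x y fun z hz => h.off z fun e => hv (e ▸ hz)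
  by_cases hr : moveRate L x y C σ = 0
  · rw [hr]
    simp
  · have h1 := hf (h.kempeFlip hv x y) (kempeFlip_mem hσ hr) (kempeFlip_mem hτ (hrτ ▸ hr))
    have h2 : ∀ ρ : V → Fin q, kempeFlip x y C ρ v = ρ v := fun ρ => if_neg hv
    rw [slack, h2, h2] at h1
    rw [slack] at hF
    have h4 := moveRate_nonneg L x y C σ
    calc _ ≤ moveRate L x y C σ * (1 / 200 * freeCount G v σ (σ v) (τ v) / D -
          1 / 200 * freeCount G v (kempeFlip x y C σ) (σ v) (τ v) / D) :=
          mul_le_mul_of_nonneg_left (by linarith) h4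
      _ = _ := by ring

/-- The flip dynamics contracts every extremal pair of colorings. -/
theorem flipGen_sub_le {f : (V → Fin q) → ℝ} (hLip : HammingLip f) (h : DifferAt v σ τ)
    (hσ : ∀ z, σ z ∈ L z) (hτ : ∀ z, τ z ∈ L z)
    (hD : ∀ z, (univ.filter (G.Adj z)).card ≤ D) (hL : LongLists D L)
    (hf : ∀ ⦃σ' τ' : V → Fin q⦄, DifferAt v σ' τ' → (∀ z, σ' z ∈ L z) → (∀ z, τ' z ∈ L z) →
      f σ' - f τ' ≤ 1 - slack G D v σ' τ')
    (hF : f σ - f τ = 1 - slack G D v σ τ) :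
    flipGen G L f σ - flipGen G L f τ ≤ - (1 / 10000) := by
  have hu := slack_nonneg (G := G) (D := D) (v := v) (σ := σ) (τ := τ)
  have hu1 := slack_le (v := v) (σ := σ) (τ := τ) hD
  have huD := slack_mul (v := v) (σ := σ) (τ := τ) hD
  have huu := slack_le_mul (G := G) (D := D) (v := v) (σ := σ) (τ := τ)
  have hU := freeCount_nonneg (G := G) (v := v) (σ := σ) (σ v) (τ v)
  have hE := loneCount_nonneg (G := G) (L := L) (v := v) (σ := σ) (σ v) (τ v)
  have hside := sum_sideTerm_le (G := G) (L := L) hLip h hσ hτ hF hu (by linarith)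
  rw [sum_nbrWeight] at hside
  have hcom := fun k => common_drift_le (k := k) h hσ hτ hD hf hF
  have hv2 : 2 ≤ (L v).card := one_lt_card.2 ⟨_, hσ v, _, hτ v, h.ne⟩
  have hLv := hL v hv2
  have hsplit : flipGen G L f σ - flipGen G L f τ =
      ∑ x, ∑ y, (sideTerm G L v f σ τ x y + sideTerm G L v (fun ρ => - f ρ) τ σ x y) +
      ∑ x, ∑ y, ∑ C ∈ commonComps G v σ τ x y, moveRate L x y C σ *
        ((f (kempeFlip x y C σ) - f (kempeFlip x y C τ)) - (f σ - f τ)) := by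
    simp only [flipGen, ← sum_sub_distrib, ← sum_add_distrib, pairGen_sub_pairGen h f]
  rw [hsplit]
  set U := freeCount G v σ (σ v) (τ v)
  set E := loneCount G L v σ (σ v) (τ v)
  set u := slack G D v σ τ
  have hN : ((univ.filter (G.Adj v)).card : ℝ) ≤ D := by exact_mod_cast hD v
  set N : ℝ := ((univ.filter (G.Adj v)).card : ℝ)
  have huN : u * N ≤ u * D := mul_le_mul_of_nonneg_left hN hu
  have hEN : E ≤ N := Nat.cast_le.2 (card_le_card (filter_subset _ _))
  have hN0 : 0 ≤ N := hE.trans hEN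
  have hD4 : 1 / 200 / (D : ℝ) * (4 * D * U) ≤ 1 / 200 * (4 * U) := by
    rcases Nat.eq_zero_or_pos D with hD0 | hD0
    · rw [hD0, Nat.cast_zero, div_zero, zero_mul]
      positivity
    · have : (D : ℝ) ≠ 0 := by positivity
      refine le_of_eq ?_
      field_simp
  by_cases h3 : 3 ≤ D
  · have h3' : (3 : ℝ) ≤ D := by exact_mod_cast h3
    have hc := hcom (D / 7) fun z hz => slack_mul_loneCount_le hL h3 hz
    have hk : 1 / 200 / (D : ℝ) * (D / 7 * E) = 1 / 1400 * E := by
      field_simp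
      ring
    rw [mul_sub, hk] at hc
    have hlist := mul_le_mul_of_nonneg_left hLv.1 (show 0 ≤ 1 - u by linarith)
    have huE : u * D = 1 / 200 * U := huD
    nlinarith
  · have h3' : (D : ℝ) ≤ 2 := by
      have : D ≤ 2 := by omega
      exact_mod_cast this
    have hc := hcom 0 fun z hz => by rw [zero_add]; exact (hL z hz).2
    rw [zero_mul, sub_zero] at hc
    have hlist := mul_le_mul_of_nonneg_left hLv.2 (show 0 ≤ 1 - u by linarith)
    nlinarith

end Contraction

section Stationarity

variable {V : Type*} [Fintype V] {q : ℕ}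

/-- The proper list-colorings of `(G, L)`. -/
noncomputable def properSet (G : SimpleGraph V) (L : V → Finset (Fin q)) : Finset (V → Fin q) :=
  univ.filter fun σ => IsProperListColoring G L σ

lemma mem_properSet {G : SimpleGraph V} {L : V → Finset (Fin q)} {σ : V → Fin q} :
    σ ∈ properSet G L ↔ IsProperListColoring G L σ := by
  simp [properSet]

lemma kempeFlip_kempeFlip (x y : Fin q) (S : Finset V) (σ : V → Fin q) :
    kempeFlip x y S (kempeFlip x y S σ) = σ := by
  funext z
  unfold kempeFlip
  split_ifs <;> simp

lemma swap_apply_mem_iff {x y s : Fin q} :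
    (Equiv.swap x y s = x ∨ Equiv.swap x y s = y) ↔ (s = x ∨ s = y) := by
  rw [Equiv.swap_apply_eq_iff, Equiv.swap_apply_eq_iff, Equiv.swap_apply_left,
    Equiv.swap_apply_right, or_comm]

variable {G : SimpleGraph V} {L : V → Finset (Fin q)} {σ : V → Fin q} {x y : Fin q}
  {S : Finset V}

lemma color_of_mem_kempeComps (hS : S ∈ kempeComps G σ x y) {z : V} (hz : z ∈ S) :
    σ z = x ∨ σ z = y := by
  obtain ⟨w, hw, rfl⟩ := mem_image.1 hS
  have hsub : graphComp (kempeGraph G σ x y) w ⊆ univ.filter fun z => σ z = x ∨ σ z = y := by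
    refine graphComp_subset_of_closed hw fun z _ z' hzz' => ?_
    obtain ⟨-, h | h⟩ := hzz'
    exacts [mem_filter.2 ⟨mem_univ _, Or.inr h.2⟩, mem_filter.2 ⟨mem_univ _, Or.inl h.2⟩]
  exact (mem_filter.1 (hsub hz)).2

lemma mem_iff_of_mem_kempeComps (hS : S ∈ kempeComps G σ x y) {w z : V}
    (h : (kempeGraph G σ x y).Adj w z) : w ∈ S ↔ z ∈ S := by
  obtain ⟨y, -, rfl⟩ := mem_image.1 hS
  exact ⟨fun hw => mem_graphComp_of_adj hw h, fun hz => mem_graphComp_of_adj hz h.symm⟩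

lemma kempeFlip_mem_iff (z : V) :
    (kempeFlip x y S σ z = x ∨ kempeFlip x y S σ z = y) ↔ (σ z = x ∨ σ z = y) := by
  unfold kempeFlip
  split_ifs
  exacts [swap_apply_mem_iff, Iff.rfl]

lemma kempeFlip_ne (hσ : ∀ u v, G.Adj u v → σ u ≠ σ v) (hS : S ∈ kempeComps G σ x y) {w z : V}
    (h : G.Adj w z) : kempeFlip x y S σ w ≠ kempeFlip x y S σ z := by
  have hmix : ∀ {w z : V}, G.Adj w z → w ∈ S → z ∉ S → Equiv.swap x y (σ w) ≠ σ z := by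
    intro w z h hw hz heq
    have hcw := color_of_mem_kempeComps hS hw
    have hadj : (kempeGraph G σ x y).Adj w z := by
      refine ⟨h, ?_⟩
      rcases hcw with hx | hy
      · rw [hx, Equiv.swap_apply_left] at heq
        exact Or.inl ⟨hx, heq.symm⟩
      · rw [hy, Equiv.swap_apply_right] at heq
        exact Or.inr ⟨hy, heq.symm⟩
    exact hz ((mem_iff_of_mem_kempeComps hS hadj).1 hw)
  unfold kempeFlip
  by_cases hw : w ∈ S <;> by_cases hz : z ∈ S
  · rw [if_pos hw, if_pos hz]
    exact fun e => hσ w z h ((Equiv.swap x y).injective e)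
  · rw [if_pos hw, if_neg hz]
    exact hmix h hw hz
  · rw [if_neg hw, if_pos hz]
    exact (hmix h.symm hz hw).symm
  · rw [if_neg hw, if_neg hz]
    exact hσ w z h

lemma kempeGraph_adj_iff (hσ : ∀ u v, G.Adj u v → σ u ≠ σ v) {w z : V} :
    (kempeGraph G σ x y).Adj w z ↔ G.Adj w z ∧ (σ w = x ∨ σ w = y) ∧ (σ z = x ∨ σ z = y) := by
  refine and_congr_right fun h => ⟨by tauto, fun ⟨h1, h2⟩ => ?_⟩
  have hne := hσ w z h
  rcases h1 with h1 | h1 <;> rcases h2 with h2 | h2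
  · exact absurd (h1.trans h2.symm) hne
  · exact Or.inl ⟨h1, h2⟩
  · exact Or.inr ⟨h1, h2⟩
  · exact absurd (h1.trans h2.symm) hne

lemma kempeComps_kempeFlip (hσ : ∀ u v, G.Adj u v → σ u ≠ σ v) (hS : S ∈ kempeComps G σ x y) :
    kempeComps G (kempeFlip x y S σ) x y = kempeComps G σ x y := by
  have hg : kempeGraph G (kempeFlip x y S σ) x y = kempeGraph G σ x y := by
    ext w z
    rw [kempeGraph_adj_iff hσ, kempeGraph_adj_iff fun u v h => kempeFlip_ne hσ hS h,
      kempeFlip_mem_iff, kempeFlip_mem_iff]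
  simp only [kempeComps, hg, kempeFlip_mem_iff]

lemma moveRate_kempeFlip (hσ : ∀ z, σ z ∈ L z) (h : moveRate L x y S σ ≠ 0) :
    moveRate L x y S (kempeFlip x y S σ) = moveRate L x y S σ := by
  have h1 : ∀ z ∈ S, Equiv.swap x y (σ z) ∈ L z := by
    by_contra hcon
    exact h (if_neg hcon)
  rw [moveRate, moveRate, if_pos h1, if_pos]
  intro z hz
  rw [kempeFlip, if_pos hz]
  simpa using hσ z

/-- The uniform distribution on proper list-colorings is stationary for the flip dynamics. -/
lemma sum_flipGen_properSet (G : SimpleGraph V) (L : V → Finset (Fin q))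
    (h : (V → Fin q) → ℝ) : ∑ σ ∈ properSet G L, flipGen G L h σ = 0 := by
  have hpair : ∀ x y, ∑ σ ∈ properSet G L, pairGen G L h σ x y = 0 := by
    intro x y
    unfold pairGen
    rw [sum_sigma']
    set T := ((properSet G L).sigma fun σ => kempeComps G σ x y).filter
      fun p => moveRate L x y p.2 p.1 ≠ 0 with hT
    have hsub : ∑ p ∈ (properSet G L).sigma fun σ => kempeComps G σ x y,
        moveRate L x y p.2 p.1 * (h (kempeFlip x y p.2 p.1) - h p.1) =
        ∑ p ∈ T, moveRate L x y p.2 p.1 * (h (kempeFlip x y p.2 p.1) - h p.1) := by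
      rw [hT, sum_filter_of_ne]
      intro p _ hp hr
      rw [hr, zero_mul] at hp
      exact hp rfl
    rw [hsub]
    simp only [mul_sub, sum_sub_distrib]
    rw [sub_eq_zero]
    have hmem : ∀ p ∈ T, (⟨kempeFlip x y p.2 p.1, p.2⟩ : Σ _ : V → Fin q, Finset V) ∈ T := by
      intro p hp
      rw [hT, mem_filter, mem_sigma, mem_properSet] at hp
      obtain ⟨⟨hp1, hp2⟩, hp3⟩ := hp
      rw [hT, mem_filter, mem_sigma, mem_properSet]
      refine ⟨⟨⟨kempeFlip_mem hp1.1 hp3, fun u v huv => kempeFlip_ne hp1.2 hp2 huv⟩, ?_⟩, ?_⟩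
      · rw [kempeComps_kempeFlip hp1.2 hp2]
        exact hp2
      · rw [moveRate_kempeFlip hp1.1 hp3]
        exact hp3
    refine sum_nbij' (fun p => ⟨kempeFlip x y p.2 p.1, p.2⟩)
      (fun p => ⟨kempeFlip x y p.2 p.1, p.2⟩) hmem hmem ?_ ?_ ?_
    · intro p _
      simp only [kempeFlip_kempeFlip]
    · intro p _
      simp only [kempeFlip_kempeFlip]
    · intro p hp
      rw [hT, mem_filter, mem_sigma, mem_properSet] at hp
      simp only [moveRate_kempeFlip hp.1.1.1 hp.2]
  simp only [flipGen]
  rw [sum_comm]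
  refine sum_eq_zero fun x _ => ?_
  rw [sum_comm]
  exact sum_eq_zero fun y _ => hpair x y

end Stationarity

section Poisson

variable {V : Type*} [Fintype V] {q : ℕ}

lemma flipGen_add (G : SimpleGraph V) (L : V → Finset (Fin q)) (g h : (V → Fin q) → ℝ)
    (σ : V → Fin q) : flipGen G L (g + h) σ = flipGen G L g σ + flipGen G L h σ := by
  simp only [flipGen, pairGen, Pi.add_apply, ← sum_add_distrib]
  refine sum_congr rfl fun x _ => sum_congr rfl fun y _ => sum_congr rfl fun S _ => ?_
  ring

lemma flipGen_smul (G : SimpleGraph V) (L : V → Finset (Fin q)) (k : ℝ) (h : (V → Fin q) → ℝ)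
    (σ : V → Fin q) : flipGen G L (k • h) σ = k * flipGen G L h σ := by
  simp only [flipGen, pairGen, Pi.smul_apply, smul_eq_mul, mul_sum]
  refine sum_congr rfl fun x _ => sum_congr rfl fun y _ => sum_congr rfl fun S _ => ?_
  ring

lemma flipGen_congr {G : SimpleGraph V} {L : V → Finset (Fin q)} {g h : (V → Fin q) → ℝ}
    (hgh : ∀ σ : V → Fin q, (∀ z, σ z ∈ L z) → g σ = h σ) {σ : V → Fin q}
    (hσ : ∀ z, σ z ∈ L z) : flipGen G L g σ = flipGen G L h σ := by
  unfold flipGen pairGen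
  refine sum_congr rfl fun x _ => sum_congr rfl fun y _ => sum_congr rfl fun S _ => ?_
  by_cases hr : moveRate L x y S σ = 0
  · rw [hr, zero_mul, zero_mul]
  · rw [hgh σ hσ, hgh _ (kempeFlip_mem hσ hr)]

lemma flipGen_const (G : SimpleGraph V) (L : V → Finset (Fin q)) (k : ℝ) (σ : V → Fin q) :
    flipGen G L (fun _ => k) σ = 0 := by
  simp [flipGen, pairGen]

/-- A function that changes by at most `M` along single-site changes between list-colorings is
`M`-Lipschitz for the Hamming distance. -/
lemma sub_le_mul_card {L : V → Finset (Fin q)} {h : (V → Fin q) → ℝ} {M : ℝ}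
    (hM : 0 ≤ M) (hh : ∀ ⦃v : V⦄ ⦃σ τ : V → Fin q⦄, DifferAt v σ τ → (∀ z, σ z ∈ L z) →
      (∀ z, τ z ∈ L z) → h σ - h τ ≤ M) (D : Finset V) :
    ∀ σ τ : V → Fin q, (∀ z, σ z ∈ L z) → (∀ z, τ z ∈ L z) → (∀ z, z ∉ D → σ z = τ z) →
      h σ - h τ ≤ M * D.card := by
  induction D using Finset.induction_on with
  | empty =>
    intro σ τ _ _ he
    rw [funext fun z => he z (notMem_empty z)]
    simp
  | insert v D hv ih =>
    intro σ τ hσ hτ he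
    set σ' := Function.update σ v (τ v) with hσ'
    have hσ'L : ∀ z, σ' z ∈ L z := by
      intro z
      rw [hσ', Function.update_apply]
      split_ifs with hz
      exacts [hz ▸ hτ z, hσ z]
    have h1 := ih σ' τ hσ'L hτ fun z hz => by
      rw [hσ', Function.update_apply]
      split_ifs with hzv
      · rw [hzv]
      · exact he z (by simp [hz, hzv])
    have h2 : h σ - h σ' ≤ M := by
      by_cases hv' : σ v = τ v
      · rw [hσ', ← hv', Function.update_eq_self, sub_self]
        exact hM
      · refine hh (v := v) ⟨fun w hw => ?_, ?_⟩ hσ hσ'L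
        · rw [hσ', Function.update_of_ne hw]
        · rwa [hσ', Function.update_self]
    rw [card_insert_of_notMem hv]
    push_cast
    linarith

/-- If the generator does not decrease `h` by more than `K` along single-site changes, then `h`
itself varies by at most `10000 * K` along such changes. -/
theorem sub_le_of_flipGen {G : SimpleGraph V} {L : V → Finset (Fin q)} {D : ℕ}
    (hD : ∀ z, (univ.filter (G.Adj z)).card ≤ D) (hL : LongLists D L) {h : (V → Fin q) → ℝ}
    {K : ℝ} (hK : 0 ≤ K)
    (hgen : ∀ ⦃v : V⦄ ⦃σ τ : V → Fin q⦄, DifferAt v σ τ → (∀ z, σ z ∈ L z) → (∀ z, τ z ∈ L z) →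
      -K ≤ flipGen G L h σ - flipGen G L h τ)
    ⦃v : V⦄ ⦃σ τ : V → Fin q⦄ (hστ : DifferAt v σ τ) (hσ : ∀ z, σ z ∈ L z)
    (hτ : ∀ z, τ z ∈ L z) : h σ - h τ ≤ 10000 * K := by
  have hslack : ∀ (v : V) (σ τ : V → Fin q), 0 < 1 - slack G D v σ τ := fun v σ τ => by
    have := slack_le (v := v) (σ := σ) (τ := τ) hD
    linarith
  set T : Finset (V × (V → Fin q) × (V → Fin q)) := univ.filter fun p =>
    DifferAt p.1 p.2.1 p.2.2 ∧ (∀ z, p.2.1 z ∈ L z) ∧ ∀ z, p.2.2 z ∈ L z with hT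
  have hmemT : ∀ {v σ τ}, DifferAt v σ τ → (∀ z, σ z ∈ L z) → (∀ z, τ z ∈ L z) →
      (v, σ, τ) ∈ T := fun h1 h2 h3 => mem_filter.2 ⟨mem_univ _, h1, h2, h3⟩
  obtain ⟨⟨v₀, σ₀, τ₀⟩, hp, hmax⟩ := T.exists_max_image
    (fun p => (h p.2.1 - h p.2.2) / (1 - slack G D p.1 p.2.1 p.2.2)) ⟨_, hmemT hστ hσ hτ⟩
  obtain ⟨h0, hσ₀, hτ₀⟩ := (mem_filter.1 hp).2
  simp only at h0 hσ₀ hτ₀ hmax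
  set M := (h σ₀ - h τ₀) / (1 - slack G D v₀ σ₀ τ₀) with hM
  have hle : ∀ ⦃v σ τ⦄, DifferAt v σ τ → (∀ z, σ z ∈ L z) → (∀ z, τ z ∈ L z) →
      h σ - h τ ≤ M * (1 - slack G D v σ τ) := fun v σ τ h1 h2 h3 =>
    (div_le_iff₀ (hslack v σ τ)).1 (hmax _ (hmemT h1 h2 h3))
  have hMK : M ≤ 10000 * K := by
    by_contra! hcon
    have hMpos : 0 < M := by linarith
    set r : (V → Fin q) → (V → Fin q) := fun ρ z => if ρ z ∈ L z then ρ z else σ z with hr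
    have hrL : ∀ ρ z, r ρ z ∈ L z := by
      intro ρ z
      simp only [hr]
      split_ifs with hz
      exacts [hz, hσ z]
    have hrid : ∀ ρ : V → Fin q, (∀ z, ρ z ∈ L z) → r ρ = ρ := fun ρ hρ =>
      funext fun z => if_pos (hρ z)
    set g : (V → Fin q) → ℝ := M⁻¹ • fun ρ => h (r ρ) with hg
    have hgL : ∀ ρ : V → Fin q, (∀ z, ρ z ∈ L z) → g ρ = (M⁻¹ • h) ρ := fun ρ hρ => by
      simp only [hg, Pi.smul_apply, hrid ρ hρ]
    have hgle : ∀ ⦃v σ' τ'⦄, DifferAt v σ' τ' → (∀ z, σ' z ∈ L z) → (∀ z, τ' z ∈ L z) →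
        g σ' - g τ' ≤ 1 - slack G D v σ' τ' := by
      intro v σ' τ' h1 h2 h3
      rw [hgL _ h2, hgL _ h3, Pi.smul_apply, Pi.smul_apply, smul_eq_mul, smul_eq_mul, ← mul_sub,
        inv_mul_le_iff₀ hMpos]
      exact hle h1 h2 h3
    have hgLip : HammingLip g := by
      intro σ' τ' B hB
      have h1 := sub_le_mul_card (L := L) (h := g) zero_le_one (fun v ρ ρ' h1 h2 h3 => by
        have := hgle h1 h2 h3
        have := slack_nonneg (G := G) (D := D) (v := v) (σ := ρ) (τ := ρ')
        linarith) B (r σ') (r τ') (hrL σ') (hrL τ') fun z hz => by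
          simp only [hr, hB z hz]
      rw [one_mul] at h1
      have h2 : ∀ ρ, g (r ρ) = g ρ := fun ρ => by
        simp only [hg, Pi.smul_apply, hrid _ (hrL ρ)]
      rwa [h2, h2] at h1
    have heq : g σ₀ - g τ₀ = 1 - slack G D v₀ σ₀ τ₀ := by
      rw [hgL _ hσ₀, hgL _ hτ₀, Pi.smul_apply, Pi.smul_apply, smul_eq_mul, smul_eq_mul, ← mul_sub,
        inv_mul_eq_iff_eq_mul₀ hMpos.ne', hM, div_mul_cancel₀ _ (hslack v₀ σ₀ τ₀).ne']
    have hcore := flipGen_sub_le hgLip h0 hσ₀ hτ₀ hD hL (fun σ' τ' h1 h2 h3 => hgle h1 h2 h3) heq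
    rw [flipGen_congr hgL hσ₀, flipGen_congr hgL hτ₀, flipGen_smul, flipGen_smul, ← mul_sub,
      inv_mul_le_iff₀ hMpos] at hcore
    have := hgen h0 hσ₀ hτ₀
    linarith
  have h1 := hle hστ hσ hτ
  have h2 := mul_le_mul_of_nonneg_right hMK (hslack v σ τ).le
  have h3 := mul_nonneg hK (slack_nonneg (G := G) (D := D) (v := v) (σ := σ) (τ := τ))
  linarith

/-- The Poisson equation of the flip dynamics is solvable. -/
theorem exists_flipGen_eq {G : SimpleGraph V} {L : V → Finset (Fin q)} {D : ℕ}
    (hD : ∀ z, (univ.filter (G.Adj z)).card ≤ D) (hL : LongLists D L)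
    {σ₀ : V → Fin q} (hσ₀ : ∀ z, σ₀ z ∈ L z) (f : (V → Fin q) → ℝ) :
    ∃ h : (V → Fin q) → ℝ, ∀ σ : V → Fin q, (∀ z, σ z ∈ L z) →
      flipGen G L h σ = h σ₀ - f σ := by
  let Φ : ((V → Fin q) → ℝ) →ₗ[ℝ] ((V → Fin q) → ℝ) :=
    { toFun := fun h σ => if ∀ z, σ z ∈ L z then flipGen G L h σ - h σ₀ else - h σ
      map_add' := fun g h => by
        funext σ
        simp only [flipGen_add, Pi.add_apply]
        split_ifs <;> ring
      map_smul' := fun k h => by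
        funext σ
        simp only [flipGen_smul, Pi.smul_apply, smul_eq_mul, RingHom.id_apply]
        split_ifs <;> ring }
  have hΦ : ∀ h σ, Φ h σ = if ∀ z, σ z ∈ L z then flipGen G L h σ - h σ₀ else - h σ :=
    fun h σ => rfl
  have hinj : Function.Injective Φ := by
    rw [← LinearMap.ker_eq_bot, LinearMap.ker_eq_bot']
    intro h h0
    have hin : ∀ σ : V → Fin q, (∀ z, σ z ∈ L z) → flipGen G L h σ = h σ₀ := fun σ hσ => by
      have := congrFun h0 σ
      rw [hΦ, if_pos hσ] at this
      exact sub_eq_zero.1 this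
    have hsub := sub_le_of_flipGen hD hL (h := h) le_rfl fun v σ τ _ hσ hτ => by
      rw [hin σ hσ, hin τ hτ]
      simp
    rw [mul_zero] at hsub
    have hconst : ∀ σ : V → Fin q, (∀ z, σ z ∈ L z) → h σ = h σ₀ := fun σ hσ => by
      have h1 := sub_le_mul_card le_rfl hsub univ σ σ₀ hσ hσ₀ fun z hz => absurd (mem_univ z) hz
      have h2 := sub_le_mul_card le_rfl hsub univ σ₀ σ hσ₀ hσ fun z hz => absurd (mem_univ z) hz
      linarith
    have hzero : h σ₀ = 0 := by
      rw [← hin σ₀ hσ₀, flipGen_congr hconst hσ₀, flipGen_const]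
    funext σ
    by_cases hσ : ∀ z, σ z ∈ L z
    · rw [hconst σ hσ, hzero, Pi.zero_apply]
    · have := congrFun h0 σ
      rw [hΦ, if_neg hσ] at this
      simpa using this
  obtain ⟨h, hh⟩ := LinearMap.injective_iff_surjective.1 hinj (-f)
  refine ⟨h, fun σ hσ => ?_⟩
  have := congrFun hh σ
  rw [hΦ, if_pos hσ, Pi.neg_apply] at this
  linarith

end Poisson

section Comparison

variable {V : Type*} [Fintype V] {q : ℕ} {G : SimpleGraph V} {L L' : V → Finset (Fin q)}

lemma card_kempeComps_mem_le_one (G : SimpleGraph V) (σ : V → Fin q) (x y : Fin q) (u : V) :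
    ((kempeComps G σ x y).filter fun S => u ∈ S).card ≤ 1 := by
  refine card_le_one.2 fun S hS T hT => ?_
  obtain ⟨hS, huS⟩ := mem_filter.1 hS
  obtain ⟨hT, huT⟩ := mem_filter.1 hT
  obtain ⟨w, -, rfl⟩ := mem_image.1 hS
  obtain ⟨z, -, rfl⟩ := mem_image.1 hT
  exact (graphComp_eq_of_mem huS).trans (graphComp_eq_of_mem huT).symm

/-- Restricting the list of a single vertex changes the generator by a bounded amount. -/
lemma abs_flipGen_sub_le {u : V} (hne : ∀ z, z ≠ u → L' z = L z) (hsub : L' u ⊆ L u)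
    {h : (V → Fin q) → ℝ} {M : ℝ} (hM : 0 ≤ M)
    (hh : ∀ (D : Finset V) (σ τ : V → Fin q), (∀ z, σ z ∈ L z) → (∀ z, τ z ∈ L z) →
      (∀ z, z ∉ D → σ z = τ z) → h σ - h τ ≤ M * D.card)
    {σ : V → Fin q} (hσ : ∀ z, σ z ∈ L z) :
    |flipGen G L h σ - flipGen G L' h σ| ≤ q * q * M := by
  have hLL : ∀ z, L' z ⊆ L z := fun z => by
    by_cases hz : z = u
    · exact hz ▸ hsub
    · rw [hne z hz]
  have hterm : ∀ x y, ∀ S : Finset V,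
      |moveRate L x y S σ * (h (kempeFlip x y S σ) - h σ) -
        moveRate L' x y S σ * (h (kempeFlip x y S σ) - h σ)| ≤ if u ∈ S then M else 0 := by
    intro x y S
    rw [← sub_mul, abs_mul]
    split_ifs with hu
    · have hle : moveRate L' x y S σ ≤ moveRate L x y S σ := by
        by_cases h' : ∀ z ∈ S, Equiv.swap x y (σ z) ∈ L' z
        · rw [moveRate, moveRate, if_pos h', if_pos fun z hz => hLL z (h' z hz)]
        · rw [moveRate, if_neg h']
          exact moveRate_nonneg L x y S σ
      have h0 := moveRate_nonneg L' x y S σ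
      rw [abs_of_nonneg (sub_nonneg.2 hle)]
      by_cases hr : moveRate L x y S σ = 0
      · rw [show moveRate L x y S σ - moveRate L' x y S σ = 0 by linarith, zero_mul]
        exact hM
      have hfl := kempeFlip_mem hσ hr
      have hoff : ∀ z, z ∉ S → kempeFlip x y S σ z = σ z := fun z hz => if_neg hz
      have habs : |h (kempeFlip x y S σ) - h σ| ≤ M * S.card :=
        abs_sub_le_iff.2 ⟨hh S _ _ hfl hσ hoff, hh S _ _ hσ hfl fun z hz => (hoff z hz).symm⟩
      calc _ ≤ moveRate L x y S σ * (M * S.card) :=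
            mul_le_mul (by linarith) habs (abs_nonneg _) (moveRate_nonneg L x y S σ)
        _ = M * (moveRate L x y S σ * S.card) := by ring
        _ ≤ M * 1 := mul_le_mul_of_nonneg_left (moveRate_mul_card_le L x y S σ) hM
        _ = M := mul_one M
    · have heq : moveRate L x y S σ = moveRate L' x y S σ := by
        have hiff : (∀ z ∈ S, Equiv.swap x y (σ z) ∈ L z) ↔
            ∀ z ∈ S, Equiv.swap x y (σ z) ∈ L' z :=
          forall₂_congr fun z hz => by rw [hne z fun hzu => hu (hzu ▸ hz)]
        simp only [moveRate, hiff]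
      rw [heq, sub_self, abs_zero, zero_mul]
  have hpair : ∀ x y, |pairGen G L h σ x y - pairGen G L' h σ x y| ≤ M := by
    intro x y
    rw [pairGen, pairGen, ← sum_sub_distrib]
    refine (abs_sum_le_sum_abs _ _).trans ((sum_le_sum fun S _ => hterm x y S).trans ?_)
    rw [← sum_filter, sum_const, nsmul_eq_mul]
    exact mul_le_of_le_one_left hM (by exact_mod_cast card_kempeComps_mem_le_one G σ x y u)
  calc |flipGen G L h σ - flipGen G L' h σ|
      ≤ ∑ _x : Fin q, ∑ _y : Fin q, M := by
        simp only [flipGen, ← sum_sub_distrib]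
        refine (abs_sum_le_sum_abs _ _).trans (sum_le_sum fun x _ => ?_)
        exact (abs_sum_le_sum_abs _ _).trans (sum_le_sum fun y _ => hpair x y)
    _ = q * q * M := by
        simp only [sum_const, card_univ, Fintype.card_fin, nsmul_eq_mul]
        ring

/-- Pinning one vertex moves the average of a Lipschitz function by a bounded amount. -/
theorem abs_average_sub_le {D : ℕ} (hD : ∀ z, (univ.filter (G.Adj z)).card ≤ D)
    (hL : LongLists D L) {u : V} (hne : ∀ z, z ≠ u → L' z = L z) (hsub : L' u ⊆ L u)
    {f : (V → Fin q) → ℝ} (hf : ∀ ⦃v : V⦄ ⦃σ τ : V → Fin q⦄, DifferAt v σ τ → f σ - f τ ≤ 2)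
    (hn : (properSet G L').Nonempty) :
    |(∑ σ ∈ properSet G L', f σ) / (properSet G L').card -
      (∑ σ ∈ properSet G L, f σ) / (properSet G L).card| ≤ 20000 * q * q := by
  have hLL : ∀ z, L' z ⊆ L z := fun z => by
    by_cases hz : z = u
    · exact hz ▸ hsub
    · rw [hne z hz]
  have hPP : properSet G L' ⊆ properSet G L := fun σ hσ =>
    mem_properSet.2 ⟨fun z => hLL z ((mem_properSet.1 hσ).1 z), (mem_properSet.1 hσ).2⟩
  have hcard : ∀ {K : V → Finset (Fin q)}, (properSet G K).Nonempty →
      (0 : ℝ) < (properSet G K).card := fun hK => by exact_mod_cast hK.card_pos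
  have hn1 := hcard (hn.mono hPP)
  have hn2 := hcard hn
  obtain ⟨σ₀, hσ₀⟩ := hn
  have hσ₀L : ∀ z, σ₀ z ∈ L z := (mem_properSet.1 (hPP hσ₀)).1
  obtain ⟨h, hh⟩ := exists_flipGen_eq hD hL hσ₀L f
  have hlip : ∀ ⦃v : V⦄ ⦃σ τ : V → Fin q⦄, DifferAt v σ τ → (∀ z, σ z ∈ L z) →
      (∀ z, τ z ∈ L z) → h σ - h τ ≤ 10000 * 2 := fun v σ τ hστ hσ hτ =>
    sub_le_of_flipGen hD hL zero_le_two (fun v' σ' τ' h1 h2 h3 => by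
      rw [hh σ' h2, hh τ' h3]
      linarith [hf h1]) hστ hσ hτ
  have havg : (∑ σ ∈ properSet G L, f σ) / (properSet G L).card = h σ₀ := by
    have h0 := sum_flipGen_properSet G L h
    rw [sum_congr rfl fun σ hσ => hh σ (mem_properSet.1 hσ).1, sum_sub_distrib, sum_const,
      nsmul_eq_mul] at h0
    rw [div_eq_iff hn1.ne']
    linarith
  have hgap : |∑ σ ∈ properSet G L', f σ - (properSet G L').card * h σ₀| ≤
      (properSet G L').card * (20000 * q * q) := by
    have h0 := sum_flipGen_properSet G L' h
    have heq : ∑ σ ∈ properSet G L', f σ - (properSet G L').card * h σ₀ =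
        - ∑ σ ∈ properSet G L', (flipGen G L h σ - flipGen G L' h σ) := by
      rw [sum_sub_distrib, h0,
        sum_congr rfl fun σ hσ => hh σ (mem_properSet.1 (hPP hσ)).1, sum_sub_distrib, sum_const,
        nsmul_eq_mul]
      ring
    rw [heq, abs_neg, ← nsmul_eq_mul]
    refine (abs_sum_le_sum_abs _ _).trans (sum_le_card_nsmul _ _ _ fun σ hσ => ?_)
    refine (abs_flipGen_sub_le hne hsub (by norm_num)
      (fun B => sub_le_mul_card (by norm_num) hlip B)
      (mem_properSet.1 (hPP hσ)).1).trans (le_of_eq ?_)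
    ring
  rw [havg, div_sub' hn2.ne', abs_div, abs_of_pos hn2, div_le_iff₀ hn2, mul_comm (20000 * _ * _)]
  exact hgap

/-- The lists `L`, with the vertices of `A` pinned to the values of `ξ`. -/
noncomputable def pinLists (L : V → Finset (Fin q)) (A : Finset V) (ξ : V → Fin q) (z : V) :
    Finset (Fin q) :=
  if z ∈ A then {ξ z} else L z

lemma mem_properSet_pinLists {A : Finset V} {ξ : V → Fin q} (hξ : ∀ z ∈ A, ξ z ∈ L z)
    {σ : V → Fin q} :
    σ ∈ properSet G (pinLists L A ξ) ↔ IsProperListColoring G L σ ∧ ∀ v ∈ A, σ v = ξ v := by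
  rw [mem_properSet]
  constructor
  · intro h
    have hA : ∀ v ∈ A, σ v = ξ v := fun v hv => by
      simpa [pinLists, hv] using h.1 v
    refine ⟨⟨fun v => ?_, h.2⟩, hA⟩
    by_cases hv : v ∈ A
    · exact hA v hv ▸ hξ v hv
    · simpa [pinLists, hv] using h.1 v
  · rintro ⟨h, hA⟩
    refine ⟨fun v => ?_, h.2⟩
    by_cases hv : v ∈ A
    · simp [pinLists, hv, hA v hv]
    · simpa [pinLists, hv] using h.1 v

lemma sum_site_eq (P : Finset (V → Fin q)) (B : Finset V) (s : V → Fin q → ℝ)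
    (K : V → Finset (Fin q)) (hP : ∀ σ ∈ P, ∀ z ∈ B, σ z ∈ K z) :
    ∑ σ ∈ P, ∑ v ∈ B, s v (σ v) =
      ∑ v ∈ B, ∑ c ∈ K v, s v c * (P.filter fun σ => σ v = c).card := by
  rw [sum_comm]
  refine sum_congr rfl fun v hv => ?_
  rw [← sum_fiberwise_of_maps_to fun σ hσ => hP σ hσ v hv]
  refine sum_congr rfl fun c _ => ?_
  rw [sum_congr rfl fun σ hσ => by rw [(mem_filter.1 hσ).2], sum_const, nsmul_eq_mul, mul_comm]

/-- The total influence of pinning one vertex on the single-site marginals is bounded. -/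
theorem sum_abs_marginal_sub_le {D : ℕ} (hD : ∀ z, (univ.filter (G.Adj z)).card ≤ D)
    (hL : LongLists D L) {u : V} (hne : ∀ z, z ≠ u → L' z = L z) (hsub : L' u ⊆ L u)
    (hn : (properSet G L').Nonempty) (B : Finset V) (K : V → Finset (Fin q))
    (hK : ∀ z ∈ B, L z ⊆ K z) :
    ∑ v ∈ B, ∑ c ∈ K v,
      |(((properSet G L').filter fun σ => σ v = c).card : ℝ) / (properSet G L').card -
        (((properSet G L).filter fun σ => σ v = c).card : ℝ) / (properSet G L).card| ≤
      20000 * q * q := by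
  set d : V → Fin q → ℝ := fun v c =>
    (((properSet G L').filter fun σ => σ v = c).card : ℝ) / (properSet G L').card -
      (((properSet G L).filter fun σ => σ v = c).card : ℝ) / (properSet G L).card with hd
  set s : V → Fin q → ℝ := fun v c => if 0 ≤ d v c then 1 else -1 with hs
  have hsd : ∀ v c, |d v c| = s v c * d v c := fun v c => by
    simp only [hs]
    split_ifs with h
    · rw [abs_of_nonneg h, one_mul]
    · rw [abs_of_neg (not_le.1 h), neg_one_mul]
  have hs1 : ∀ v c, |s v c| ≤ 1 := fun v c => by
    simp only [hs]
    split_ifs <;> simp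
  have hf : ∀ ⦃v : V⦄ ⦃σ τ : V → Fin q⦄, DifferAt v σ τ →
      ∑ w ∈ B, s w (σ w) - ∑ w ∈ B, s w (τ w) ≤ 2 := by
    intro v σ τ h
    rw [← sum_sub_distrib]
    calc ∑ w ∈ B, (s w (σ w) - s w (τ w)) ≤ ∑ w ∈ B, if w = v then (2 : ℝ) else 0 := by
          refine sum_le_sum fun w _ => ?_
          split_ifs with hw
          · linarith [(abs_le.1 (hs1 w (σ w))).2, (abs_le.1 (hs1 w (τ w))).1]
          · rw [h.off w hw, sub_self]
      _ ≤ 2 := by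
          rw [sum_ite_eq']
          split_ifs <;> norm_num
  have hLL : ∀ z, L' z ⊆ L z := fun z => by
    by_cases hz : z = u
    · exact hz ▸ hsub
    · rw [hne z hz]
  have hmain := (le_abs_self _).trans (abs_average_sub_le hD hL hne hsub hf hn)
  rw [sum_site_eq _ B s K fun σ hσ z hz => hK z hz (hLL z ((mem_properSet.1 hσ).1 z)),
    sum_site_eq _ B s K fun σ hσ z hz => hK z hz ((mem_properSet.1 hσ).1 z),
    sum_div, sum_div, ← sum_sub_distrib] at hmain
  refine le_trans (le_of_eq (sum_congr rfl fun v _ => ?_)) hmain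
  rw [sum_div, sum_div, ← sum_sub_distrib]
  refine sum_congr rfl fun c _ => ?_
  rw [show _ = _ from hsd v c]
  simp only [hd]
  ring

lemma properCount_eq [DecidableEq V] (Q : (V → Fin q) → Prop) (P : Finset (V → Fin q))
    (h : ∀ σ, σ ∈ P ↔ IsProperListColoring G L σ ∧ Q σ) : properCount G L Q = P.card := by
  unfold properCount
  congr 1
  ext σ
  rw [mem_filter, h]
  simp

end Comparison

/-- spectral independence for proper list-colorings below the `11/6`
threshold.  There is a constant `ε > 0` such that for all integers `q, Δ` there is a constant
`η = η(q,Δ)` with: for every list-coloring instance `(G, L)` with maximum degree at most `Δ`,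
lists `L v ⊆ Fin q`, and `|L v| ≥ max((11/6 − ε)Δ, Δ+2)` for all `v`, the uniform distribution
`μ` over proper list-colorings satisfies, for every partial proper list-coloring `ξ` on
`A ⊆ V` extending to a full proper list-coloring, every `u ∉ A` and every color `c` with
`Pr_{σ∼μ∣ξ}[σ(u)=c] > 0`:
`∑_{v∈V∖A} ∑_{c'∈L v} |Pr_{σ∼μ∣ξ}[σ(v)=c' ∣ σ(u)=c] − Pr_{σ∼μ∣ξ}[σ(v)=c']| ≤ η`
(all the probabilities are ratios of counts of proper list-colorings). -/
theorem list_coloring_spectral_independence :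
    ∃ ε : ℝ, 0 < ε ∧
      ∀ q Δ : ℕ, ∃ η : ℝ,
        ∀ (V : Type) [Fintype V] [DecidableEq V],
          ∀ (G : SimpleGraph V) (L : V → Finset (Fin q)),
            (∀ v : V, (Finset.univ.filter fun w => G.Adj v w).card ≤ Δ) →
            (∀ v : V,
              max (((11 : ℝ) / 6 - ε) * (Δ : ℝ)) ((Δ : ℝ) + 2) ≤ ((L v).card : ℝ)) →
            ∀ (A : Finset V) (ξ : V → Fin q),
              (∃ σ : V → Fin q, IsProperListColoring G L σ ∧ ∀ v ∈ A, σ v = ξ v) →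
              ∀ u : V, u ∉ A → ∀ c : Fin q,
                0 < properCount G L (fun σ => (∀ v ∈ A, σ v = ξ v) ∧ σ u = c) →
                ∑ v ∈ Finset.univ \ A, ∑ c' ∈ L v,
                    |(properCount G L
                          (fun σ => (∀ w ∈ A, σ w = ξ w) ∧ σ u = c ∧ σ v = c') : ℝ) /
                        (properCount G L (fun σ => (∀ w ∈ A, σ w = ξ w) ∧ σ u = c) : ℝ) -
                      (properCount G L (fun σ => (∀ w ∈ A, σ w = ξ w) ∧ σ v = c') : ℝ) /
                        (properCount G L (fun σ => ∀ w ∈ A, σ w = ξ w) : ℝ)|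
                  ≤ η := by
  refine ⟨1 / 10000, by norm_num, fun q D => ⟨20000 * q * q, ?_⟩⟩
  intro V _ _ G L hD hL A ξ ⟨σ₁, hσ₁, hσ₁A⟩ u hu c hc
  have hξ : ∀ z ∈ A, ξ z ∈ L z := fun z hz => hσ₁A z hz ▸ hσ₁.1 z
  rw [properCount, card_pos] at hc
  obtain ⟨σ₂, h_mem⟩ := hc
  obtain ⟨hσ₂, hσ₂A, hσ₂u⟩ := by simpa only [mem_filter_univ] using h_mem
  set L₁ := pinLists L A ξ with hL₁
  set L₂ : V → Finset (Fin q) := pinLists L₁ {u} fun _ => c with hL₂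
  have hL₁u : L₁ u = L u := if_neg hu
  have hcu : ∀ z ∈ ({u} : Finset V), c ∈ L₁ z := fun z hz => by
    rw [mem_singleton.1 hz, hL₁u, ← hσ₂u]
    exact hσ₂.1 u
  have h₁ : ∀ σ, σ ∈ properSet G L₁ ↔ IsProperListColoring G L σ ∧ ∀ v ∈ A, σ v = ξ v :=
    fun σ => mem_properSet_pinLists hξ
  have h₂ : ∀ σ, σ ∈ properSet G L₂ ↔
      IsProperListColoring G L σ ∧ (∀ v ∈ A, σ v = ξ v) ∧ σ u = c := fun σ => by
    rw [hL₂, mem_properSet_pinLists hcu, ← mem_properSet, h₁, and_assoc]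
    simp
  have hlong : LongLists D L₁ := fun z hz => by
    by_cases hzA : z ∈ A
    · simp [hL₁, pinLists, hzA] at hz
    · rw [hL₁, pinLists, if_neg hzA]
      exact max_le_iff.1 (hL z)
  have hne : ∀ z, z ≠ u → L₂ z = L₁ z := fun z hz => if_neg (by simpa using hz)
  have hsub : L₂ u ⊆ L₁ u := by
    rw [hL₂, pinLists, if_pos (mem_singleton_self u), singleton_subset_iff]
    exact hcu u (mem_singleton_self u)
  have hbound := sum_abs_marginal_sub_le hD hlong hne hsub
    ⟨σ₂, (h₂ σ₂).2 ⟨hσ₂, hσ₂A, hσ₂u⟩⟩ (univ \ A) L fun z hz => by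
      rw [hL₁, pinLists, if_neg (mem_sdiff.1 hz).2]
  refine le_trans (le_of_eq (sum_congr rfl fun v _ => sum_congr rfl fun c' _ => ?_)) hbound
  rw [properCount_eq _ (properSet G L₂) h₂, properCount_eq _ (properSet G L₁) h₁,
    properCount_eq _ ((properSet G L₂).filter fun σ => σ v = c') fun σ => by
      rw [mem_filter, h₂, and_assoc, and_assoc],
    properCount_eq _ ((properSet G L₁).filter fun σ => σ v = c') fun σ => by
      rw [mem_filter, h₁, and_assoc]]
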